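/- arXiv:2206.10037 — 2 statements merged into one kernel-verified Lean document; each statement's English description precedes it below -/
import Mathlib

section
/- Let A ⊆ {1, …, N} have density α = |A|/N and contain no nontrivial three-term arithmetic progression. Then either N < 8/α², or there exist integers a, q ≥ 1 and N' with N' ≥ α⁴√N/2²¹ such that the arithmetic progression P = {a + q, a + 2q, …, a + N'q} satisfies P ⊆ {1, …, N} and |A ∩ P|/|P| ≥ α + α²/2¹¹. -/
open Finset in
/-- Summing a function supported on `{1,…,N}` over a long enough interval of translates. -/
lemma sum_Icc_translate_eq {E : Type*} [AddCommMonoid E] (g : ℤ → E) (N K t : ℤ)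
    (hg : ∀ x, x ∉ Icc 1 N → g x = 0) (ht : 0 ≤ t) (htK : t ≤ K) :
    ∑ a ∈ Icc (1 - K) N, g (a + t) = ∑ x ∈ Icc 1 N, g x := by
  have h1 : ∑ a ∈ Icc (1 - K) N, g (a + t) = ∑ x ∈ Icc (1 - K + t) (N + t), g x := by
    rw [← Finset.image_add_right_Icc, Finset.sum_image]
    intro x _ y _ h
    simpa using h
  rw [h1]
  symm
  apply Finset.sum_subset
  · apply Finset.Icc_subset_Icc <;> linarith
  · intro x _ hx
    exact hg x hx

/-- The additive character `t ↦ exp(2πit)` of the real line. -/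
noncomputable def realChar (t : ℝ) : ℂ := Complex.exp ((2 * Real.pi * t : ℝ) * Complex.I)

lemma realChar_add (s t : ℝ) : realChar (s + t) = realChar s * realChar t := by
  unfold realChar
  rw [← Complex.exp_add]
  congr 1
  push_cast
  ring

lemma norm_realChar (t : ℝ) : ‖realChar t‖ = 1 := Complex.norm_exp_ofReal_mul_I _

lemma realChar_int (n : ℤ) : realChar n = 1 := by
  unfold realChar
  rw [Complex.exp_eq_one_iff]
  exact ⟨n, by push_cast; ring⟩

lemma realChar_nat_mul (n : ℕ) (t : ℝ) : realChar (n * t) = realChar t ^ n := by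
  unfold realChar
  rw [← Complex.exp_nat_mul]
  congr 1
  push_cast
  ring

lemma realChar_neg (t : ℝ) : realChar (-t) = (starRingEnd ℂ) (realChar t) := by
  unfold realChar
  rw [← Complex.exp_conj, map_mul, Complex.conj_ofReal, Complex.conj_I]
  congr 1
  push_cast
  ring

lemma norm_realChar_sub_one_le (t : ℝ) (j : ℤ) :
    ‖realChar t - 1‖ ≤ 2 * Real.pi * |t - j| := by
  have h : realChar t = realChar (t - j) := by
    conv_lhs => rw [show t = (t - j) + j by ring, realChar_add, realChar_int, mul_one]
  rw [h]
  unfold realChar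
  rw [mul_comm]
  refine (Real.norm_exp_I_mul_ofReal_sub_one_le).trans ?_
  rw [Real.norm_eq_abs, abs_mul, abs_of_pos (by positivity)]

open Finset in
lemma sum_realChar_div (M : ℕ) (n : ℤ) (hn : |n| < M) :
    ∑ r ∈ range M, realChar (r * (n / M)) = if n = 0 then (M : ℂ) else 0 := by
  have hM : 0 < M := by have := abs_nonneg n; omega
  have hM' : (M : ℝ) ≠ 0 := by positivity
  simp_rw [realChar_nat_mul]
  split_ifs with h
  · subst h
    have : realChar 0 = 1 := by simpa using realChar_int 0
    simp [this]
  · have hz : realChar ((n : ℝ) / M) ≠ 1 := by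
      intro h1
      unfold realChar at h1
      rw [Complex.exp_eq_one_iff] at h1
      obtain ⟨k, hk⟩ := h1
      have hπ : (2 * Real.pi * Complex.I : ℂ) ≠ 0 := Complex.two_pi_I_ne_zero
      have h2 : ((n / M : ℝ) : ℂ) = (k : ℝ) := by
        apply mul_right_cancel₀ hπ
        push_cast at hk ⊢
        rw [← hk]
        ring
      have h3 : (n : ℝ) / M = k := by exact_mod_cast h2
      rw [div_eq_iff hM'] at h3
      have h4 : n = k * M := by exact_mod_cast h3
      exact h (Int.eq_zero_of_abs_lt_dvd (Dvd.intro_left k h4.symm) hn)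
    have h1 := mul_geom_sum (realChar ((n : ℝ) / M)) M
    have h2 : realChar ((n : ℝ) / M) ^ M = 1 := by
      rw [← realChar_nat_mul, mul_div_cancel₀ _ hM', realChar_int]
    rw [h2, sub_self] at h1
    exact (mul_eq_zero.mp h1).resolve_left (sub_ne_zero.mpr hz)

open Finset in
/-- Parseval's identity for the indicator function of a set of small diameter. -/
lemma sum_norm_sq_sum_realChar (M : ℕ) (A : Finset ℤ)
    (hA : ∀ x ∈ A, ∀ y ∈ A, |x - y| < (M : ℤ)) :
    ∑ r ∈ range M, ‖∑ x ∈ A, realChar (r * (x / M))‖ ^ 2 = M * #A := by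
  have h : ∀ r ∈ range M, ((‖∑ x ∈ A, realChar (r * (x / M))‖ ^ 2 : ℝ) : ℂ) =
      ∑ x ∈ A, ∑ y ∈ A, realChar (r * ((x - y : ℤ) / M)) := by
    intro r _
    push_cast
    rw [← Complex.mul_conj', map_sum, sum_mul_sum]
    refine sum_congr rfl fun x _ => sum_congr rfl fun y _ => ?_
    rw [← realChar_neg, ← realChar_add]
    congr 1
    ring
  have h2 : ((∑ r ∈ range M, ‖∑ x ∈ A, realChar (r * (x / M))‖ ^ 2 : ℝ) : ℂ) =
      ((M * #A : ℝ) : ℂ) := by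
    rw [Complex.ofReal_sum, sum_congr rfl h, sum_comm]
    have : ∀ x ∈ A, ∑ r ∈ range M, ∑ y ∈ A, realChar (r * ((x - y : ℤ) / M)) = M := by
      intro x hx
      rw [sum_comm, sum_congr rfl fun y hy => sum_realChar_div M (x - y) (hA x hx y hy)]
      simp [sub_eq_zero, hx]
    rw [sum_congr rfl this]
    simp [mul_comm]
  exact_mod_cast h2

open Finset in
/-- The Fourier expression of the number of solutions of `x + z = 2y`. -/
lemma sum_sq_mul_realChar_eq (M : ℕ) (A B : Finset ℤ) (f : ℤ → ℝ)
    (hAB : ∀ x ∈ A, ∀ z ∈ A, ∀ y ∈ B, |x + z - 2 * y| < (M : ℤ)) :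
    ∑ r ∈ range M, (∑ x ∈ A, realChar (r * (x / M))) ^ 2 *
        ∑ y ∈ B, (f y : ℂ) * realChar (-2 * r / M * y) =
      M * ((∑ x ∈ A, ∑ z ∈ A, ∑ y ∈ B, if x + z = 2 * y then f y else 0 : ℝ) : ℂ) := by
  have h : ∀ r ∈ range M, (∑ x ∈ A, realChar (r * (x / M))) ^ 2 *
        ∑ y ∈ B, (f y : ℂ) * realChar (-2 * r / M * y) =
      ∑ x ∈ A, ∑ z ∈ A, ∑ y ∈ B, (f y : ℂ) * realChar (r * ((x + z - 2 * y : ℤ) / M)) := by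
    intro r _
    rw [sq, sum_mul_sum, sum_mul]
    refine sum_congr rfl fun x _ => ?_
    rw [sum_mul]
    refine sum_congr rfl fun z _ => ?_
    rw [mul_sum]
    refine sum_congr rfl fun y _ => ?_
    have : (r * ((x + z - 2 * y : ℤ) / M) : ℝ) = r * (x / M) + r * (z / M) + -2 * r / M * y := by
      push_cast; ring
    rw [this, realChar_add, realChar_add]
    ring
  rw [sum_congr rfl h, sum_comm, Complex.ofReal_sum, mul_sum]
  refine sum_congr rfl fun x hx => ?_
  rw [sum_comm, Complex.ofReal_sum, mul_sum]
  refine sum_congr rfl fun z hz => ?_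
  rw [sum_comm, Complex.ofReal_sum, mul_sum]
  refine sum_congr rfl fun y hy => ?_
  rw [← mul_sum, sum_realChar_div M _ (hAB x hx z hz y hy)]
  simp only [sub_eq_zero]
  split_ifs <;> simp [mul_comm]

open Finset in
lemma sum_ite_add_eq_two_mul (N x z : ℤ) (hx : x ∈ Icc 1 N) (hz : z ∈ Icc 1 N) :
    (∑ y ∈ Icc 1 N, if x + z = 2 * y then (1 : ℝ) else 0) =
      (1 + (if Even x then 1 else -1) * (if Even z then 1 else -1)) / 2 := by
  rw [mem_Icc] at hx hz
  by_cases h : Even (x + z)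
  · obtain ⟨w, hw⟩ := h
    have h1 : ∀ y, x + z = 2 * y ↔ w = y := by intro y; omega
    have h2 : w ∈ Icc 1 N := by rw [mem_Icc]; omega
    have h3 : Even x ↔ Even z := Int.even_add.mp ⟨w, hw⟩
    simp_rw [h1, sum_ite_eq, if_pos h2, h3]
    split_ifs <;> norm_num
  · have h1 : ∀ y, ¬ x + z = 2 * y := fun y hy => h ⟨y, by omega⟩
    rw [Int.even_add] at h
    simp_rw [if_neg (h1 _)]
    by_cases hx : Even x <;> by_cases hz : Even z <;> simp_all [-Int.not_even_iff_odd]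

open Finset in
/-- The balanced function `1_A - α 1_{[1,N]}` of a subset of `{1,…,N}`. -/
noncomputable def balanced (N : ℕ) (A : Finset ℤ) (x : ℤ) : ℝ :=
  (if x ∈ A then 1 else 0) - (#A / N : ℝ) * (if x ∈ Icc 1 (N : ℤ) then 1 else 0)

open Finset in
lemma sum_sum_sum_balanced_le (N : ℕ) (A : Finset ℤ) (hAN : A ⊆ Icc 1 (N : ℤ))
    (hA : ¬ ∃ x y : ℤ, y ≠ 0 ∧ x ∈ A ∧ x + y ∈ A ∧ x + 2 * y ∈ A) :
    (∑ x ∈ A, ∑ z ∈ A, ∑ y ∈ Icc 1 (N : ℤ), if x + z = 2 * y then balanced N A y else 0) ≤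
      #A - (#A / N : ℝ) * #A ^ 2 / 2 := by
  set α : ℝ := #A / N
  have hα : 0 ≤ α := by positivity
  have key : ∀ x ∈ A, ∀ z ∈ A,
      (∑ y ∈ Icc 1 (N : ℤ), if x + z = 2 * y then balanced N A y else 0) ≤
        (if x = z then 1 else 0) -
          α * ((1 + (if Even x then 1 else -1) * (if Even z then 1 else -1)) / 2) := by
    intro x hx z hz
    rw [← sum_ite_add_eq_two_mul N x z (hAN hx) (hAN hz)]
    have h1 : ∀ y ∈ Icc 1 (N : ℤ), (if x + z = 2 * y then balanced N A y else 0) =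
        (if x + z = 2 * y ∧ y ∈ A then (1 : ℝ) else 0) -
          α * (if x + z = 2 * y then 1 else 0) := by
      intro y hy
      unfold balanced
      rw [if_pos hy]
      by_cases h : x + z = 2 * y <;> simp [h, α]
    rw [sum_congr rfl h1, sum_sub_distrib, ← mul_sum]
    apply sub_le_sub_right
    have h2 : ∀ y ∈ Icc 1 (N : ℤ), (if x + z = 2 * y ∧ y ∈ A then (1 : ℝ) else 0) ≤
        if x = y then (if x = z then 1 else 0) else 0 := by
      intro y _
      by_cases h : x + z = 2 * y ∧ y ∈ A
      · have hxy : x = y := by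
          by_contra hne
          refine hA ⟨x, y - x, by omega, hx, ?_, ?_⟩
          · convert h.2 using 1; ring
          · convert hz using 1; linarith [h.1]
        have hxz : x = z := by omega
        rw [if_pos h, if_pos hxy, if_pos hxz]
      · rw [if_neg h]
        split_ifs <;> norm_num
    refine (sum_le_sum h2).trans ?_
    rw [sum_ite_eq, if_pos (hAN hx)]
  refine (sum_le_sum fun x hx => sum_le_sum fun z hz => key x hx z hz).trans ?_
  set s : ℝ := ∑ x ∈ A, if Even x then 1 else -1 with hs
  have h3 : ∑ x ∈ A, ∑ z ∈ A, ((if x = z then (1 : ℝ) else 0) -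
      α * ((1 + (if Even x then 1 else -1) * (if Even z then 1 else -1)) / 2)) =
      #A - α * ((#A ^ 2 + s ^ 2) / 2) := by
    simp_rw [sum_sub_distrib, sum_ite_eq, ← mul_sum, ← sum_div, sum_add_distrib, ← mul_sum,
      ← sum_mul, ← hs]
    simp only [sum_ite_mem, inter_self, sum_const, nsmul_eq_mul, mul_one]
    ring
  rw [h3]
  nlinarith [mul_nonneg hα (sq_nonneg s)]

open Finset in
/-- The balanced function of a set without three-term progressions has a large Fourier
coefficient. -/
lemma exists_large_fourier_coefficient (N : ℕ) (A : Finset ℤ) (hAN : A ⊆ Icc 1 (N : ℤ))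
    (hA : ¬ ∃ x y : ℤ, y ≠ 0 ∧ x ∈ A ∧ x + y ∈ A ∧ x + 2 * y ∈ A)
    (hN : 8 ≤ (#A / N : ℝ) ^ 2 * N) :
    ∃ θ : ℝ, (#A / N : ℝ) ^ 2 / 4 * N ≤
      ‖∑ y ∈ Icc 1 (N : ℤ), (balanced N A y : ℂ) * realChar (θ * y)‖ := by
  by_contra! hcon
  have hN0 : 0 < N := by
    rcases Nat.eq_zero_or_pos N with h | h
    · subst h; norm_num at hN
    · exact h
  have hNR : (0 : ℝ) < N := by exact_mod_cast hN0
  set α : ℝ := #A / N with hα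
  have hαA : (#A : ℝ) = α * N := by rw [hα]; field_simp
  have hα0 : 0 < α := by
    have h0 : 0 ≤ α := div_nonneg (Nat.cast_nonneg _) hNR.le
    rcases h0.eq_or_lt with h | h
    · rw [← h] at hN; norm_num at hN
    · exact h
  have bd : ∀ x ∈ Icc 1 (N : ℤ), ∀ z ∈ Icc 1 (N : ℤ), ∀ y ∈ Icc 1 (N : ℤ),
      |x + z - 2 * y| < ((2 * N : ℕ) : ℤ) := by
    intro x hx z hz y hy
    rw [mem_Icc] at hx hy hz
    rw [abs_lt]
    push_cast
    constructor <;> linarith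
  have h1 := sum_sq_mul_realChar_eq (2 * N) A (Icc 1 (N : ℤ)) (balanced N A)
    fun x hx z hz y hy => bd x (hAN hx) z (hAN hz) y hy
  have h2 := sum_norm_sq_sum_realChar (2 * N) A (by
    intro x hx y hy
    have hx := hAN hx
    have hy := hAN hy
    rw [mem_Icc] at hx hy
    rw [abs_lt]
    push_cast
    constructor <;> linarith)
  have h3 := sum_sum_sum_balanced_le N A hAN hA
  set T : ℝ := ∑ x ∈ A, ∑ z ∈ A, ∑ y ∈ Icc 1 (N : ℤ), if x + z = 2 * y then balanced N A y else 0
  have h4 : ‖((2 * N : ℕ) : ℂ) * (T : ℂ)‖ ≤ (α ^ 2 / 4 * N) * ((2 * N : ℕ) * #A) := by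
    rw [← h1, ← h2, mul_sum]
    refine (norm_sum_le _ _).trans (sum_le_sum fun r _ => ?_)
    rw [norm_mul, norm_pow, mul_comm]
    exact mul_le_mul_of_nonneg_right (hcon _).le (by positivity)
  rw [norm_mul, Complex.norm_natCast, Complex.norm_real, Real.norm_eq_abs] at h4
  have h5 : |T| ≤ α ^ 2 / 4 * N * #A := by
    have : (0 : ℝ) < (2 * N : ℕ) := by positivity
    refine le_of_mul_le_mul_left ?_ this
    linarith
  have h6 := (abs_le.mp h5).1
  rw [← hα, hαA] at h3
  rw [hαA] at h6
  have h7 : 0 < α * N := mul_pos hα0 hNR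
  nlinarith [mul_le_mul_of_nonneg_left hN h7.le]

open Finset in
/-- A function on `{1,…,N}` of mean zero with a large Fourier coefficient is biased on a
progression along which the phase is almost constant. -/
lemma exists_window_of_large_fourier_coefficient (N : ℕ) (f : ℤ → ℝ)
    (hsupp : ∀ x, x ∉ Icc 1 (N : ℤ) → f x = 0) (hf : ∀ x, |f x| ≤ 1)
    (hf0 : ∑ x ∈ Icc 1 (N : ℤ), f x = 0) (θ δ c : ℝ) (L : ℕ) (q : ℤ) (hL : 1 ≤ L) (hq : 1 ≤ q)
    (hδ : δ * N ≤ ‖∑ x ∈ Icc 1 (N : ℤ), (f x : ℂ) * realChar (θ * x)‖)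
    (hphase : ∀ i ∈ Icc (1 : ℤ) L, ‖realChar (θ * (i * q : ℤ)) - 1‖ ≤ δ / 4)
    (hc : 0 ≤ c) (hLq : 2 * c * N + 4 * L * q < 3 / 4 * δ * N) :
    ∃ a : ℤ, 1 ≤ a + q ∧ a + L * q ≤ N ∧ c * L ≤ ∑ i ∈ Icc (1 : ℤ) L, f (a + i * q) := by
  by_contra! hcon
  set S : ℤ → ℝ := fun a => ∑ i ∈ Icc (1 : ℤ) L, f (a + i * q) with hS
  set W := Icc (1 - L * q) (N : ℤ) with hW
  have hLR : (1 : ℝ) ≤ L := by exact_mod_cast hL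
  have hLZ : (1 : ℤ) ≤ L := by exact_mod_cast hL
  have shift : ∀ {E : Type} [AddCommMonoid E] (g : ℤ → E),
      (∀ x, x ∉ Icc 1 (N : ℤ) → g x = 0) →
      ∑ a ∈ W, ∑ i ∈ Icc (1 : ℤ) L, g (a + i * q) = L • ∑ x ∈ Icc 1 (N : ℤ), g x := by
    intro E _ g hg
    rw [sum_comm, sum_congr rfl fun i hi => sum_Icc_translate_eq g N (L * q) (i * q) hg ?_ ?_]
    · simp
    · rw [mem_Icc] at hi
      nlinarith
    · rw [mem_Icc] at hi
      nlinarith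
  have hsum : ∑ a ∈ W, S a = 0 := by
    rw [hS, shift f hsupp, hf0, smul_zero]
  have habs : ∑ a ∈ W, ∑ i ∈ Icc (1 : ℤ) L, |f (a + i * q)| ≤ L * N := by
    rw [shift (fun x => |f x|) fun x hx => by simp [hsupp x hx], nsmul_eq_mul]
    refine mul_le_mul_of_nonneg_left ?_ (by positivity)
    refine (sum_le_sum fun x _ => hf x).trans ?_
    simp
  have hwindow : ∀ a ∈ W, ‖∑ i ∈ Icc (1 : ℤ) L,
      (f (a + i * q) : ℂ) * realChar (θ * (a + i * q : ℤ))‖ ≤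
        |S a| + δ / 4 * ∑ i ∈ Icc (1 : ℤ) L, |f (a + i * q)| := by
    intro a _
    have h1 : ∑ i ∈ Icc (1 : ℤ) L, (f (a + i * q) : ℂ) * realChar (θ * (a + i * q : ℤ)) =
        realChar (θ * a) * ((S a : ℂ) + ∑ i ∈ Icc (1 : ℤ) L,
          (f (a + i * q) : ℂ) * (realChar (θ * (i * q : ℤ)) - 1)) := by
      rw [hS, Complex.ofReal_sum, ← sum_add_distrib, mul_sum]
      refine sum_congr rfl fun i _ => ?_
      rw [Int.cast_add, mul_add, realChar_add]
      ring
    rw [h1, norm_mul, norm_realChar, one_mul]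
    refine (norm_add_le _ _).trans ?_
    rw [Complex.norm_real, Real.norm_eq_abs, mul_sum]
    gcongr
    refine (norm_sum_le _ _).trans (sum_le_sum fun i hi => ?_)
    rw [norm_mul, Complex.norm_real, Real.norm_eq_abs, mul_comm]
    exact mul_le_mul_of_nonneg_right (hphase i hi) (abs_nonneg _)
  have hδ0 : 0 ≤ δ / 4 := (norm_nonneg _).trans (hphase 1 (by simp [hL]))
  have hlower : L * (δ * N) ≤ ∑ a ∈ W, |S a| + δ / 4 * (L * N) := by
    calc L * (δ * N)
        ≤ L * ‖∑ x ∈ Icc 1 (N : ℤ), (f x : ℂ) * realChar (θ * x)‖ := by gcongr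
      _ = ‖∑ a ∈ W, ∑ i ∈ Icc (1 : ℤ) L,
            (f (a + i * q) : ℂ) * realChar (θ * (a + i * q : ℤ))‖ := by
          rw [shift (fun x => (f x : ℂ) * realChar (θ * x)) fun x hx => by simp [hsupp x hx],
            nsmul_eq_mul, norm_mul, Complex.norm_natCast]
      _ ≤ ∑ a ∈ W, (|S a| + δ / 4 * ∑ i ∈ Icc (1 : ℤ) L, |f (a + i * q)|) :=
          (norm_sum_le _ _).trans (sum_le_sum hwindow)
      _ ≤ ∑ a ∈ W, |S a| + δ / 4 * (L * N) := by
          rw [sum_add_distrib, ← mul_sum]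
          gcongr
  have hSabs : ∀ a, |S a| ≤ L := by
    intro a
    refine (abs_sum_le_sum_abs _ _).trans ((sum_le_sum fun i _ => hf _).trans ?_)
    simp
  set U := Icc (1 - q) ((N : ℤ) - L * q)
  set V₁ := Icc (1 - L * q) (-q)
  set V₂ := Icc ((N : ℤ) - L * q + 1) (N : ℤ)
  have hpoint : ∀ a ∈ W, |S a| + S a ≤ (if a ∈ U then 2 * c * L else 0) +
      ((if a ∈ V₁ then 2 * (L : ℝ) else 0) + (if a ∈ V₂ then 2 * (L : ℝ) else 0)) := by
    intro a ha
    rw [hW, mem_Icc] at ha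
    have h2 : |S a| + S a ≤ 2 * L := by linarith [hSabs a, le_abs_self (S a)]
    have p1 : (0 : ℝ) ≤ if a ∈ V₁ then 2 * (L : ℝ) else 0 := by split_ifs <;> positivity
    have p2 : (0 : ℝ) ≤ if a ∈ V₂ then 2 * (L : ℝ) else 0 := by split_ifs <;> positivity
    have p3 : (0 : ℝ) ≤ if a ∈ U then 2 * c * (L : ℝ) else 0 := by split_ifs <;> positivity
    by_cases h₁ : a ∈ V₁
    · rw [if_pos h₁]; linarith
    by_cases h₂ : a ∈ V₂
    · rw [if_pos h₂]; linarith
    have hU : a ∈ U := by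
      simp only [U, V₁, V₂, mem_Icc, not_and, not_le] at *
      constructor
      · have := h₁ ha.1; omega
      · by_contra! h
        have := h₂ (by omega)
        omega
    have h3 : S a < c * L := by
      simp only [U, mem_Icc] at hU
      exact hcon a (by linarith) (by linarith)
    rw [if_pos hU]
    have h4 : 0 ≤ c * L := by positivity
    rcases abs_cases (S a) with h | h <;> linarith
  have hcard : ∀ (X : Finset ℤ) (v : ℝ), 0 ≤ v → ∑ a ∈ W, (if a ∈ X then v else 0) ≤ #X * v := by
    intro X v hv
    rw [sum_ite_mem, sum_const, nsmul_eq_mul]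
    gcongr
    exact inter_subset_right
  have hV₁ : (#V₁ : ℝ) ≤ L * q := by
    have h : (#V₁ : ℤ) ≤ L * q := by
      simp only [V₁, Int.card_Icc, Int.ofNat_toNat]
      exact max_le (by linarith) (by positivity)
    exact_mod_cast h
  have hV₂ : (#V₂ : ℝ) ≤ L * q := by
    have h : (#V₂ : ℤ) ≤ L * q := by
      simp only [V₂, Int.card_Icc, Int.ofNat_toNat]
      exact max_le (by linarith) (by positivity)
    exact_mod_cast h
  have hU : (#U : ℝ) ≤ N := by
    have h : (#U : ℤ) ≤ N := by
      simp only [U, Int.card_Icc, Int.ofNat_toNat]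
      exact max_le (by nlinarith) (by positivity)
    exact_mod_cast h
  have hupper : ∑ a ∈ W, |S a| ≤ N * (2 * c * L) + (L * q * (2 * L) + L * q * (2 * L)) := by
    calc ∑ a ∈ W, |S a| = ∑ a ∈ W, (|S a| + S a) := by rw [sum_add_distrib, hsum, add_zero]
      _ ≤ _ := sum_le_sum hpoint
      _ ≤ #U * (2 * c * L) + (#V₁ * (2 * L) + #V₂ * (2 * L)) := by
          rw [sum_add_distrib, sum_add_distrib]
          exact add_le_add (hcard _ _ (by positivity))
            (add_le_add (hcard _ _ (by positivity)) (hcard _ _ (by positivity)))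
      _ ≤ _ := by gcongr
  have : L * (3 / 4 * δ * N) ≤ L * (2 * c * N + 4 * L * q) := by nlinarith
  have := le_of_mul_le_mul_left this (by positivity)
  linarith

open Finset in
/-- Among three consecutive integers at most two lie in a set without three-term
progressions. -/
lemma three_mul_card_le_of_no_progression (N : ℕ) (A : Finset ℤ) (hAN : A ⊆ Icc 1 (N : ℤ))
    (hA : ¬ ∃ x y : ℤ, y ≠ 0 ∧ x ∈ A ∧ x + y ∈ A ∧ x + 2 * y ∈ A) :
    3 * #A ≤ 2 * (N + 2) := by
  have h1 : ∀ t ∈ Icc (0 : ℤ) 2,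
      ∑ a ∈ Icc (1 - 2) (N : ℤ), (if a + t ∈ A then 1 else 0) = #A := by
    intro t ht
    rw [mem_Icc] at ht
    rw [sum_Icc_translate_eq (fun x => if x ∈ A then 1 else 0) N 2 t
      (fun x hx => if_neg fun h => hx (hAN h)) ht.1 ht.2, sum_ite_mem, inter_eq_right.mpr hAN]
    simp
  have h2 : ∀ a ∈ Icc (1 - 2) (N : ℤ), (if a + 0 ∈ A then 1 else 0) +
      ((if a + 1 ∈ A then 1 else 0) + (if a + 2 ∈ A then 1 else 0)) ≤ 2 := by
    intro a _
    by_cases h : a ∈ A ∧ a + 1 ∈ A ∧ a + 2 ∈ A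
    · exact absurd ⟨a, 1, one_ne_zero, h.1, h.2.1, by simpa using h.2.2⟩ hA
    · rw [add_zero]
      split_ifs <;> simp_all
  have h3 := sum_le_sum h2
  rw [sum_add_distrib, sum_add_distrib, h1 0 (by simp), h1 1 (by simp), h1 2 (by simp)] at h3
  simp at h3
  omega

open Finset in
lemma balanced_eq_zero (N : ℕ) (A : Finset ℤ) (hAN : A ⊆ Icc 1 (N : ℤ)) (x : ℤ)
    (hx : x ∉ Icc 1 (N : ℤ)) : balanced N A x = 0 := by
  unfold balanced
  rw [if_neg hx, if_neg fun h => hx (hAN h)]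
  simp

open Finset in
lemma card_div_le_one (N : ℕ) (A : Finset ℤ) (hAN : A ⊆ Icc 1 (N : ℤ)) : (#A / N : ℝ) ≤ 1 := by
  have h := card_le_card hAN
  rw [Int.card_Icc] at h
  apply div_le_one_of_le₀ _ (by positivity)
  exact_mod_cast (by omega : #A ≤ N)

open Finset in
lemma abs_balanced_le_one (N : ℕ) (A : Finset ℤ) (hAN : A ⊆ Icc 1 (N : ℤ)) (x : ℤ) :
    |balanced N A x| ≤ 1 := by
  have h1 := card_div_le_one N A hAN
  have h0 : (0 : ℝ) ≤ #A / N := by positivity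
  unfold balanced
  rw [abs_le]
  split_ifs <;> constructor <;> linarith

open Finset in
lemma sum_balanced (N : ℕ) (hN : 0 < N) (A : Finset ℤ) (hAN : A ⊆ Icc 1 (N : ℤ)) :
    ∑ x ∈ Icc 1 (N : ℤ), balanced N A x = 0 := by
  have : (N : ℝ) ≠ 0 := by positivity
  unfold balanced
  rw [sum_sub_distrib, ← mul_sum, sum_ite_mem, sum_ite_mem, inter_eq_right.mpr hAN, inter_self]
  simp
  field_simp
  simp

open Finset in
/-- A window on which the balanced function is biased is a progression on which the density
increases. -/
lemma density_add_le_of_sum_balanced (N L : ℕ) (A : Finset ℤ) (a q : ℤ) (c : ℝ) (hL : 1 ≤ L)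
    (hq : 1 ≤ q) (hP : ((Icc (1 : ℤ) L).image fun i => a + i * q) ⊆ Icc 1 (N : ℤ))
    (hc : c * L ≤ ∑ i ∈ Icc (1 : ℤ) L, balanced N A (a + i * q)) :
    (#A / N : ℝ) + c ≤ (#(A ∩ (Icc (1 : ℤ) L).image fun i => a + i * q) : ℝ) /
      #((Icc (1 : ℤ) L).image fun i => a + i * q) := by
  have hinj : Set.InjOn (fun i : ℤ => a + i * q) (Icc (1 : ℤ) L) := by
    intro i _ j _ h
    have h : a + i * q = a + j * q := h
    exact mul_right_cancel₀ (by omega : q ≠ 0) (add_left_cancel h)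
  set P := (Icc (1 : ℤ) L).image fun i => a + i * q with hPdef
  have hcard : #P = L := by rw [hPdef, card_image_of_injOn hinj]; simp
  have hLR : (0 : ℝ) < L := by exact_mod_cast hL
  rw [hcard, le_div_iff₀ hLR]
  have hsum : ∑ i ∈ Icc (1 : ℤ) L, balanced N A (a + i * q) = ∑ x ∈ P, balanced N A x := by
    rw [hPdef, sum_image hinj]
  have h2 : ∑ x ∈ P, balanced N A x = #(A ∩ P) - (#A / N : ℝ) * L := by
    unfold balanced
    rw [sum_sub_distrib, ← mul_sum, sum_ite_mem, sum_ite_mem, inter_eq_left.mpr hP,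
      inter_comm P A]
    simp [hcard]
  rw [hsum, h2] at hc
  linarith


/-- Roth's density-increment lemma: a subset of `{1,…,N}` of density `α` without nontrivial
three-term arithmetic progressions either satisfies `N < 8/α²` (i.e. `α²·N < 8`) or has
density at least `α + α²/2¹¹` on an arithmetic progression
`P = {a+q, a+2q, …, a+N'q} ⊆ {1,…,N}` of length `N' ≥ α⁴√N/2²¹`. -/
theorem roth_density_increment (N : ℕ) (A : Finset ℤ) (hAN : A ⊆ Finset.Icc 1 (N : ℤ))
    (hA : ¬ ∃ x y : ℤ, y ≠ 0 ∧ x ∈ A ∧ x + y ∈ A ∧ x + 2 * y ∈ A) :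
    (((A.card : ℝ) / N) ^ 2 * N < 8) ∨
      ∃ (a q : ℤ) (N' : ℕ), 1 ≤ q ∧
        ((A.card : ℝ) / N) ^ 4 * Real.sqrt N / 2 ^ 21 ≤ (N' : ℝ) ∧
        ((Finset.Icc (1 : ℤ) (N' : ℤ)).image fun i => a + i * q) ⊆ Finset.Icc 1 (N : ℤ) ∧
        ((A ∩ ((Finset.Icc (1 : ℤ) (N' : ℤ)).image fun i => a + i * q)).card : ℝ) /
            (((Finset.Icc (1 : ℤ) (N' : ℤ)).image fun i => a + i * q).card) ≥
          (A.card : ℝ) / N + ((A.card : ℝ) / N) ^ 2 / 2 ^ 11 := by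
  set α : ℝ := (A.card : ℝ) / N with hα
  by_cases hN : α ^ 2 * N < 8
  · exact Or.inl hN
  right
  push Not at hN
  have hN0 : 0 < N := by
    rcases Nat.eq_zero_or_pos N with h | h
    · subst h; norm_num at hN
    · exact h
  have hNR : (0 : ℝ) < N := by exact_mod_cast hN0
  have hα0 : 0 ≤ α := by positivity
  have hα1 : α ≤ 1 := card_div_le_one N A hAN
  have hαsq : α ^ 2 ≤ 1 := pow_le_one₀ hα0 hα1
  have hN8 : (8 : ℝ) ≤ N := by nlinarith
  suffices H : ∃ (a q : ℤ) (L : ℕ), 1 ≤ L ∧ 1 ≤ q ∧ α ^ 4 * Real.sqrt N / 2 ^ 21 ≤ (L : ℝ) ∧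
      1 ≤ a + q ∧ a + L * q ≤ N ∧
      α ^ 2 / 2 ^ 11 * L ≤ ∑ i ∈ Finset.Icc (1 : ℤ) L, balanced N A (a + i * q) by
    obtain ⟨a, q, L, hL, hq, hlen, h1, h2, h3⟩ := H
    have hP : ((Finset.Icc (1 : ℤ) (L : ℤ)).image fun i => a + i * q) ⊆
        Finset.Icc 1 (N : ℤ) := by
      intro x hx
      rw [Finset.mem_image] at hx
      obtain ⟨i, hi, rfl⟩ := hx
      rw [Finset.mem_Icc] at hi ⊢
      constructor <;> nlinarith
    exact ⟨a, q, L, hq, hlen, hP, density_add_le_of_sum_balanced N L A a q _ hL hq hP h3⟩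
  by_cases hsmall : α ^ 4 * Real.sqrt N / 2 ^ 21 ≤ 1
  · have hne : A.Nonempty := by
      rw [Finset.nonempty_iff_ne_empty]
      rintro rfl
      norm_num [hα] at hN
    obtain ⟨x, hx⟩ := hne
    have hxN := Finset.mem_Icc.mp (hAN hx)
    refine ⟨x - 1, 1, 1, le_rfl, le_rfl, by simpa using hsmall, by linarith,
      by push_cast; linarith, ?_⟩
    have h3 : (3 * A.card : ℝ) ≤ 2 * (N + 2) := by
      exact_mod_cast three_mul_card_le_of_no_progression N A hAN hA
    have h4 : α ≤ 5 / 6 := by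
      rw [hα, div_le_iff₀ hNR]
      linarith
    have h5 : balanced N A x = 1 - α := by
      unfold balanced
      rw [if_pos hx, if_pos (hAN hx), mul_one]
    simp [h5]
    linarith
  push Not at hsmall
  set R := Real.sqrt N with hR
  have hRR : R * R = N := Real.mul_self_sqrt hNR.le
  have hR1 : 1 ≤ R := by
    rw [hR, Real.one_le_sqrt]
    linarith
  have hα4 : α ^ 4 ≤ α ^ 2 := pow_le_pow_of_le_one hα0 hα1 (by norm_num)
  obtain ⟨θ, hθ⟩ := exists_large_fourier_coefficient N A hAN hA hN
  rw [← hα] at hθ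
  obtain ⟨j, q, hq0, hqn, hjq⟩ :=
    Real.exists_int_int_abs_mul_sub_le θ (n := ⌊R⌋₊) (Nat.floor_pos.mpr hR1)
  have hqR : (q : ℝ) ≤ R := by
    have h1 : (q : ℝ) ≤ (⌊R⌋₊ : ℝ) := by exact_mod_cast hqn
    exact h1.trans (Nat.floor_le (by linarith))
  have hjR : |q * θ - j| ≤ 1 / R :=
    hjq.trans (one_div_le_one_div_of_le (by linarith) (Nat.lt_floor_add_one R).le)
  set L := ⌈α ^ 4 * R / 2 ^ 21⌉₊ with hL
  have hL1 : 1 ≤ L := Nat.one_le_ceil_iff.mpr (by linarith)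
  have hLlt : (L : ℝ) ≤ α ^ 4 * R / 2 ^ 20 := by
    have := Nat.ceil_lt_add_one (a := α ^ 4 * R / 2 ^ 21) (by linarith)
    rw [← hL] at this
    linarith
  have hphase : ∀ i ∈ Finset.Icc (1 : ℤ) L,
      ‖realChar (θ * (i * q : ℤ)) - 1‖ ≤ α ^ 2 / 4 / 4 := by
    intro i hi
    rw [Finset.mem_Icc] at hi
    have hi0 : (0 : ℝ) ≤ i := by exact_mod_cast (by omega : 0 ≤ i)
    have hiL : (i : ℝ) ≤ L := by exact_mod_cast hi.2
    refine (norm_realChar_sub_one_le _ (i * j)).trans ?_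
    have h1 : θ * ((i * q : ℤ) : ℝ) - ((i * j : ℤ) : ℝ) = i * (q * θ - j) := by push_cast; ring
    rw [h1, abs_mul, abs_of_nonneg hi0]
    have h2 : (i : ℝ) * |q * θ - j| ≤ α ^ 4 * R / 2 ^ 20 * (1 / R) := by
      gcongr
      exact hiL.trans hLlt
    have h3 : α ^ 4 * R / 2 ^ 20 * (1 / R) = α ^ 4 / 2 ^ 20 := by field_simp
    rw [h3] at h2
    have h4 := Real.pi_le_four
    have h5 : 2 * Real.pi * (i * |q * θ - j|) ≤ 2 * 4 * (α ^ 4 / 2 ^ 20) := by gcongr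
    linarith [sq_nonneg α]
  have hLq : 2 * (α ^ 2 / 2 ^ 11) * N + 4 * L * q < 3 / 4 * (α ^ 2 / 4) * N := by
    have h1 : (L : ℝ) * q ≤ α ^ 4 * R / 2 ^ 20 * R := by
      gcongr
    have h2 : α ^ 4 * R / 2 ^ 20 * R = α ^ 4 * N / 2 ^ 20 := by rw [← hRR]; ring
    have h3 : α ^ 4 * N ≤ α ^ 2 * N := by gcongr
    have h4 : 0 < α ^ 2 * N := by linarith
    linarith
  obtain ⟨a, h1, h2, h3⟩ := exists_window_of_large_fourier_coefficient N (balanced N A)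
    (balanced_eq_zero N A hAN) (abs_balanced_le_one N A hAN) (sum_balanced N hN0 A hAN)
    θ (α ^ 2 / 4) (α ^ 2 / 2 ^ 11) L q hL1 hq0 hθ hphase (by positivity) hLq
  exact ⟨a, q, L, hL1, hq0, Nat.le_ceil _, h1, h2, h3⟩
end

section
/- There exists an absolute constant C > 0 such that the following holds. Let p ≥ 2 be real, 0 < ε < 1, and let A ⊆ 𝔽_3^n be nonempty of density α = |A|/3^n with α ≤ 1/2. Then there exists a linear subspace V ≤ 𝔽_3^n of codimension at most C·(log(1/(εα)))^C·p/ε² such that ‖μ_A * 1_A * μ_V − μ_A * 1_A‖_{L^p} ≤ ε·‖μ_A * 1_A‖_{L^{p/2}}^{1/2} + ε². -/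
open scoped Classical

variable {G : Type*} [AddCommGroup G] [Fintype G]

/-- Average of a function over a finite type. -/
noncomputable def expect (f : G → ℝ) : ℝ := (∑ x, f x) / Fintype.card G

/-- Normalized convolution `(f * g)(x) = 𝔼_y f(x − y) g(y)`. -/
noncomputable def conv (f g : G → ℝ) : G → ℝ := fun x => expect fun y => f (x - y) * g y

/-- The `L^p` norm `‖f‖_{L^p} = (𝔼_x |f(x)|^p)^{1/p}` (with normalized counting measure). -/
noncomputable def lpNorm (p : ℝ) (f : G → ℝ) : ℝ := (expect fun x => |f x| ^ p) ^ (1 / p)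

/-- The indicator function `1_A`. -/
noncomputable def ind (A : Finset G) : G → ℝ := fun x => if x ∈ A then 1 else 0

/-- The normalized indicator `μ_A = 1_A / μ(A)`, of mean 1. -/
noncomputable def nind (A : Finset G) : G → ℝ :=
  fun x => if x ∈ A then (Fintype.card G : ℝ) / A.card else 0

/-- The normalized indicator `μ_V` of a subspace `V ≤ 𝔽₃ⁿ`. -/
noncomputable def nindSub {n : ℕ} (V : Submodule (ZMod 3) (Fin n → ZMod 3)) :
    (Fin n → ZMod 3) → ℝ :=
  fun x => if x ∈ V then (3 : ℝ) ^ n / Nat.card V else 0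

/-! ### Averages over translates and the `L^p` norm -/

/-- The average of the translates of `f` by the elements of `T`, i.e. `f * μ_T`. -/
noncomputable def avgTranslate (T : Finset G) (f : G → ℝ) : G → ℝ :=
  fun x => (∑ t ∈ T, f (x - t)) / T.card

omit [Fintype G] in
theorem avgTranslate_sub (T : Finset G) (f g : G → ℝ) :
    avgTranslate T (f - g) = avgTranslate T f - avgTranslate T g := by
  funext x
  simp [avgTranslate, Finset.sum_sub_distrib, sub_div]

theorem conv_nind (f : G → ℝ) (T : Finset G) : conv f (nind T) = avgTranslate T f := by
  funext x
  have hG : (Fintype.card G : ℝ) ≠ 0 := by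
    have : Nonempty G := ⟨0⟩
    exact_mod_cast Fintype.card_ne_zero
  simp only [conv, expect, nind, avgTranslate, mul_ite, mul_zero, Finset.sum_ite_mem,
    Finset.univ_inter, ← Finset.sum_mul]
  field_simp

theorem conv_comm (f g : G → ℝ) : conv f g = conv g f := by
  funext x
  simp only [conv, expect]
  congr 1
  refine Fintype.sum_equiv (Equiv.subLeft x) _ _ fun y => ?_
  simp [mul_comm]

theorem lpNorm_nonneg (p : ℝ) (f : G → ℝ) : 0 ≤ lpNorm p f := by
  unfold lpNorm expect
  positivity

theorem lpNorm_add_le {p : ℝ} (hp : 1 ≤ p) (f g : G → ℝ) :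
    lpNorm p (f + g) ≤ lpNorm p f + lpNorm p g := by
  unfold lpNorm expect
  rw [Real.div_rpow (by positivity) (by positivity), Real.div_rpow (by positivity) (by positivity),
    Real.div_rpow (by positivity) (by positivity), ← add_div]
  gcongr
  exact Real.Lp_add_le _ _ _ hp

omit [AddCommGroup G] in
theorem lpNorm_zero {p : ℝ} (hp : 0 < p) : lpNorm p (0 : G → ℝ) = 0 := by
  simp [lpNorm, expect, Real.zero_rpow hp.ne', Real.zero_rpow (inv_pos.mpr hp).ne']

omit [AddCommGroup G] in
theorem lpNorm_sub_comm (p : ℝ) (f g : G → ℝ) : lpNorm p (f - g) = lpNorm p (g - f) := by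
  simp only [lpNorm, Pi.sub_apply, abs_sub_comm]

theorem lpNorm_translate (p : ℝ) (f : G → ℝ) (t : G) :
    lpNorm p (fun x => f (x - t)) = lpNorm p f := by
  unfold lpNorm expect
  congr 2
  exact Fintype.sum_equiv (Equiv.subRight t) _ _ fun x => rfl

theorem lpNorm_div {p : ℝ} (hp : 0 < p) (f : G → ℝ) {c : ℝ} (hc : 0 ≤ c) :
    lpNorm p (fun x => f x / c) = lpNorm p f / c := by
  unfold lpNorm expect
  simp_rw [abs_div, abs_of_nonneg hc, Real.div_rpow (abs_nonneg _) hc, ← Finset.sum_div]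
  rw [div_right_comm, Real.div_rpow (by positivity) (by positivity), ← Real.rpow_mul hc,
    mul_one_div_cancel hp.ne', Real.rpow_one]

theorem lpNorm_le_of_forall {p c : ℝ} (hp : 0 < p) (f : G → ℝ) (h : ∀ x, |f x| ≤ c) :
    lpNorm p f ≤ c := by
  have hc : 0 ≤ c := (abs_nonneg _).trans (h 0)
  have hG : (0 : ℝ) < Fintype.card G := by
    have : Nonempty G := ⟨0⟩
    exact_mod_cast Fintype.card_pos
  have h1 : expect (fun x => |f x| ^ p) ≤ c ^ p := by
    unfold expect
    rw [div_le_iff₀ hG, mul_comm]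
    calc ∑ x, |f x| ^ p ≤ ∑ _x : G, c ^ p := by
          gcongr with x
          exact h x
      _ = _ := by simp
  calc lpNorm p f ≤ (c ^ p) ^ (1 / p) := by
        unfold lpNorm
        exact Real.rpow_le_rpow (by unfold expect; positivity) h1 (by positivity)
    _ = c := by rw [← Real.rpow_mul hc, mul_one_div_cancel hp.ne', Real.rpow_one]

theorem lpNorm_le_of_sum_le {p c : ℝ} (hp : 0 < p) (hc : 0 ≤ c) (f : G → ℝ)
    (h : ∑ x, |f x| ^ p ≤ c ^ p * Fintype.card G) : lpNorm p f ≤ c := by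
  have hG : (0 : ℝ) < Fintype.card G := by
    have : Nonempty G := ⟨0⟩
    exact_mod_cast Fintype.card_pos
  calc lpNorm p f ≤ (c ^ p) ^ (1 / p) := by
        unfold lpNorm
        refine Real.rpow_le_rpow (by unfold expect; positivity) ?_ (by positivity)
        unfold expect
        rwa [div_le_iff₀ hG]
    _ = c := by rw [← Real.rpow_mul hc, mul_one_div_cancel hp.ne', Real.rpow_one]

/-- Minkowski's inequality for averages of translates, relative to a fixed function. -/
theorem lpNorm_avgTranslate_sub_le {p δ : ℝ} (hp : 1 ≤ p) {T : Finset G} (hT : T.Nonempty)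
    (f g : G → ℝ) (h : ∀ t ∈ T, lpNorm p ((fun x => f (x - t)) - g) ≤ δ) :
    lpNorm p (avgTranslate T f - g) ≤ δ := by
  have hp0 : 0 < p := by linarith
  have hT0 : (0 : ℝ) < T.card := by exact_mod_cast hT.card_pos
  have h1 : avgTranslate T f - g =
      fun x => (∑ t ∈ T, ((fun x => f (x - t)) - g)) x / (T.card : ℝ) := by
    funext x
    simp only [avgTranslate, Pi.sub_apply, Finset.sum_apply, Finset.sum_sub_distrib,
      Finset.sum_const, nsmul_eq_mul]
    field_simp
  rw [h1, lpNorm_div hp0 _ hT0.le, div_le_iff₀ hT0]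
  calc _ ≤ ∑ t ∈ T, lpNorm p ((fun x => f (x - t)) - g) :=
        Finset.le_sum_of_subadditive _ (lpNorm_zero hp0).le (fun a b => lpNorm_add_le hp a b) _ _
    _ ≤ ∑ _t ∈ T, δ := Finset.sum_le_sum h
    _ = δ * T.card := by simp [mul_comm]

theorem lpNorm_avgTranslate_le {p : ℝ} (hp : 1 ≤ p) {T : Finset G} (hT : T.Nonempty)
    (f : G → ℝ) : lpNorm p (avgTranslate T f) ≤ lpNorm p f := by
  have := lpNorm_avgTranslate_sub_le hp hT f 0 (δ := lpNorm p f) fun t _ => by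
    rw [sub_zero, lpNorm_translate]
  simpa using this

theorem lpNorm_iterate_avgTranslate_sub_le {p δ : ℝ} (hp : 1 ≤ p) {T : Finset G}
    (hT : T.Nonempty) (f : G → ℝ)
    (h : ∀ t ∈ T, lpNorm p ((fun x => f (x - t)) - f) ≤ δ) (r : ℕ) :
    lpNorm p ((avgTranslate T)^[r] f - f) ≤ r * δ := by
  induction r with
  | zero => simp [lpNorm_zero (by linarith : 0 < p)]
  | succ r ih =>
    have h1 : (avgTranslate T)^[r + 1] f - f =
        avgTranslate T ((avgTranslate T)^[r] f - f) + (avgTranslate T f - f) := by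
      rw [Function.iterate_succ_apply', avgTranslate_sub]
      abel
    rw [h1]
    calc _ ≤ _ := lpNorm_add_le hp _ _
      _ ≤ r * δ + δ := add_le_add ((lpNorm_avgTranslate_le hp hT _).trans ih)
          (lpNorm_avgTranslate_sub_le hp hT f f h)
      _ = _ := by push_cast; ring

/-! ### A moment bound for sums of independent centred variables -/

/-- The exponential moment bound, for uniform samples from `A`. -/
theorem sum_piFinset_exp_le {ι : Type*} (A : Finset ι) (g : ι → ℝ) (q l : ℝ) (k : ℕ)
    (h0 : ∑ a ∈ A, g a = 0) (h1 : ∀ a ∈ A, |g a| ≤ 1) (h2 : ∑ a ∈ A, g a ^ 2 ≤ A.card * q)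
    (hl : |l| ≤ 1) :
    ∑ a ∈ Fintype.piFinset (fun _ : Fin k => A), Real.exp (l * ∑ i, g (a i)) ≤
      (A.card : ℝ) ^ k * Real.exp (l ^ 2 * (k * q)) := by
  have h3 : ∑ a ∈ A, Real.exp (l * g a) ≤ A.card * Real.exp (l ^ 2 * q) := by
    calc ∑ a ∈ A, Real.exp (l * g a) ≤ ∑ a ∈ A, (1 + l * g a + l ^ 2 * g a ^ 2) := by
          gcongr with a ha
          have : |l * g a| ≤ 1 := by
            rw [abs_mul]
            exact mul_le_one₀ hl (abs_nonneg _) (h1 a ha)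
          have := (abs_le.mp (Real.abs_exp_sub_one_sub_id_le this)).2
          nlinarith
      _ = A.card + l ^ 2 * ∑ a ∈ A, g a ^ 2 := by
          simp [Finset.sum_add_distrib, ← Finset.mul_sum, h0]
      _ ≤ A.card * (l ^ 2 * q + 1) := by nlinarith [mul_le_mul_of_nonneg_left h2 (sq_nonneg l)]
      _ ≤ _ := by
          gcongr
          exact Real.add_one_le_exp _
  calc _ = (∑ a ∈ A, Real.exp (l * g a)) ^ k := by
        rw [Finset.sum_pow']
        simp_rw [Finset.mul_sum, Real.exp_sum]
    _ ≤ (A.card * Real.exp (l ^ 2 * q)) ^ k := by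
        gcongr
    _ = _ := by
        rw [mul_pow, ← Real.exp_nat_mul]
        ring_nf

theorem rpow_le_mul_exp_add_exp {p l : ℝ} (hp : 0 < p) (hl : 0 < l) (s : ℝ) :
    |s| ^ p ≤ (p / l) ^ p * (Real.exp (l * s) + Real.exp (-l * s)) := by
  have h1 : |s| = p / l * (l * |s| / p) := by field_simp
  have h2 : (l * |s| / p) ^ p ≤ Real.exp (l * |s|) := by
    calc (l * |s| / p) ^ p ≤ (Real.exp (l * |s| / p)) ^ p := by
          gcongr
          linarith [Real.add_one_le_exp (l * |s| / p)]
      _ = _ := by rw [← Real.exp_mul]; congr 1; field_simp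
  have h3 : Real.exp (l * |s|) ≤ Real.exp (l * s) + Real.exp (-l * s) := by
    rcases abs_cases s with ⟨h, _⟩ | ⟨h, _⟩ <;> rw [h]
    · linarith [Real.exp_pos (-l * s)]
    · rw [mul_neg, ← neg_mul]
      linarith [Real.exp_pos (l * s)]
  calc |s| ^ p = (p / l) ^ p * (l * |s| / p) ^ p := by
        rw [← Real.mul_rpow (by positivity) (by positivity), ← h1]
    _ ≤ _ := by gcongr; exact h2.trans h3

theorem sum_piFinset_rpow_le {ι : Type*} (A : Finset ι) (g : ι → ℝ) {p q : ℝ} (k : ℕ)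
    (hp : 0 < p) (hq : 0 ≤ q)
    (h0 : ∑ a ∈ A, g a = 0) (h1 : ∀ a ∈ A, |g a| ≤ 1) (h2 : ∑ a ∈ A, g a ^ 2 ≤ A.card * q) :
    ∑ a ∈ Fintype.piFinset (fun _ : Fin k => A), |∑ i, g (a i)| ^ p ≤
      (A.card : ℝ) ^ k * (2 * Real.exp p * (p ^ p + (p * k * q) ^ (p / 2))) := by
  obtain ⟨l, hl0, hl1, hl2, hl3⟩ : ∃ l : ℝ, 0 < l ∧ l ≤ 1 ∧ l ^ 2 * (k * q) ≤ p ∧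
      (p / l) ^ p ≤ p ^ p + (p * k * q) ^ (p / 2) := by
    have hkq : 0 ≤ k * q := by positivity
    by_cases h : k * q ≤ p
    · refine ⟨1, one_pos, le_rfl, by linarith, ?_⟩
      rw [div_one]
      have : 0 ≤ (p * k * q) ^ (p / 2) := by positivity
      linarith
    · push Not at h
      have hkq' : 0 < k * q := hp.trans h
      refine ⟨√(p / (k * q)), by positivity, ?_, ?_, ?_⟩
      · rw [Real.sqrt_le_one, div_le_one hkq']
        exact h.le
      · rw [Real.sq_sqrt (by positivity), div_mul_cancel₀ _ hkq'.ne']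
      · have h4 : p / √(p / (k * q)) = √(p * k * q) := by
          rw [div_eq_iff (by positivity), ← Real.sqrt_mul (by positivity)]
          have : p * k * q * (p / (k * q)) = p ^ 2 := by
            rw [mul_assoc p, mul_div_assoc', mul_right_comm, mul_div_cancel_right₀ _ hkq'.ne']
            ring
          rw [this, Real.sqrt_sq hp.le]
        rw [h4, Real.sqrt_eq_rpow, ← Real.rpow_mul (by positivity)]
        have : 0 ≤ p ^ p := by positivity
        rw [show 1 / 2 * p = p / 2 by ring]
        linarith
  have habs : |l| ≤ 1 := by rw [abs_of_pos hl0]; exact hl1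
  calc _ ≤ ∑ a ∈ Fintype.piFinset (fun _ : Fin k => A), (p / l) ^ p *
        (Real.exp (l * ∑ i, g (a i)) + Real.exp (-l * ∑ i, g (a i))) := by
        gcongr with a
        exact rpow_le_mul_exp_add_exp hp hl0 _
    _ = (p / l) ^ p * (∑ a ∈ Fintype.piFinset (fun _ : Fin k => A),
        Real.exp (l * ∑ i, g (a i)) + ∑ a ∈ Fintype.piFinset (fun _ : Fin k => A),
          Real.exp (-l * ∑ i, g (a i))) := by
        rw [← Finset.mul_sum, Finset.sum_add_distrib]
    _ ≤ (p / l) ^ p * ((A.card : ℝ) ^ k * Real.exp p + (A.card : ℝ) ^ k * Real.exp p) := by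
        gcongr
        · refine (sum_piFinset_exp_le A g q l k h0 h1 h2 habs).trans ?_
          gcongr
        · refine (sum_piFinset_exp_le A g q (-l) k h0 h1 h2 (by rwa [abs_neg])).trans ?_
          rw [neg_sq]
          gcongr
    _ = (A.card : ℝ) ^ k * (2 * Real.exp p * (p / l) ^ p) := by ring
    _ ≤ _ := by gcongr

/-! ### Almost-periods via random sampling -/

omit [Fintype G] in
theorem avgTranslate_mem_Icc {f : G → ℝ} (hf : ∀ x, f x ∈ Set.Icc (0 : ℝ) 1) (T : Finset G)
    (x : G) : avgTranslate T f x ∈ Set.Icc (0 : ℝ) 1 := by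
  refine ⟨div_nonneg (Finset.sum_nonneg fun t _ => (hf _).1) (Nat.cast_nonneg _),
    div_le_one_of_le₀ ?_ (Nat.cast_nonneg _)⟩
  calc ∑ t ∈ T, f (x - t) ≤ ∑ _t ∈ T, (1 : ℝ) := Finset.sum_le_sum fun t _ => (hf _).2
    _ = T.card := by simp

/-- The `p`-th power of the `L^p` error made when `f * μ_A` is replaced by an average of `k`
translates, summed over all samples `a ∈ A^k`. -/
theorem sum_piFinset_sum_rpow_le {f : G → ℝ} (hf : ∀ x, f x ∈ Set.Icc (0 : ℝ) 1) {A : Finset G}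
    (hA : A.Nonempty) {p : ℝ} (hp : 0 < p) (k : ℕ) :
    ∑ a ∈ Fintype.piFinset (fun _ : Fin k => A),
        ∑ x, |∑ i, (f (x - a i) - avgTranslate A f x)| ^ p ≤
      (A.card : ℝ) ^ k * (2 * Real.exp p * (p ^ p + (p * k) ^ (p / 2) *
        lpNorm (p / 2) (avgTranslate A f) ^ (p / 2)) * Fintype.card G) := by
  have hG : (0 : ℝ) < Fintype.card G := by
    have : Nonempty G := ⟨0⟩
    exact_mod_cast Fintype.card_pos
  have hA0 : (0 : ℝ) < A.card := by exact_mod_cast hA.card_pos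
  set F := avgTranslate A f with hF
  have hF01 : ∀ x, F x ∈ Set.Icc (0 : ℝ) 1 := avgTranslate_mem_Icc hf A
  have hnorm : lpNorm (p / 2) F ^ (p / 2) * Fintype.card G = ∑ x, F x ^ (p / 2) := by
    unfold lpNorm expect
    rw [← Real.rpow_mul (by positivity), one_div_mul_cancel (by positivity), Real.rpow_one,
      div_mul_cancel₀ _ hG.ne']
    exact Finset.sum_congr rfl fun x _ => by simp only [abs_of_nonneg (hF01 x).1]
  rw [Finset.sum_comm]
  calc _ ≤ ∑ x, (A.card : ℝ) ^ k *
        (2 * Real.exp p * (p ^ p + (p * k * F x) ^ (p / 2))) := by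
        refine Finset.sum_le_sum fun x _ => ?_
        have hsum : ∑ a ∈ A, f (x - a) = A.card * F x := by
          rw [hF]
          simp only [avgTranslate]
          field_simp
        refine sum_piFinset_rpow_le A (fun a => f (x - a) - F x) k hp (hF01 x).1 ?_ ?_ ?_
        · simp [Finset.sum_sub_distrib, hsum]
        · intro a _
          have h1 := hf (x - a)
          have h2 := hF01 x
          exact abs_le.mpr ⟨by linarith [h1.1, h2.2], by linarith [h1.2, h2.1]⟩
        · calc ∑ a ∈ A, (f (x - a) - F x) ^ 2
              ≤ ∑ a ∈ A, (f (x - a) - 2 * F x * f (x - a) + F x ^ 2) := by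
                gcongr with a
                nlinarith [(hf (x - a)).1, (hf (x - a)).2]
            _ = A.card * F x - A.card * F x ^ 2 := by
                rw [Finset.sum_add_distrib, Finset.sum_sub_distrib, ← Finset.mul_sum, hsum,
                  Finset.sum_const, nsmul_eq_mul]
                ring
            _ ≤ A.card * F x := by nlinarith [sq_nonneg (F x)]
    _ = _ := by
        rw [← Finset.mul_sum, ← Finset.mul_sum, Finset.sum_add_distrib, mul_assoc _ (_ + _),
          add_mul, mul_assoc _ (_ ^ (p / 2)), hnorm, Finset.mul_sum]
        simp only [Finset.sum_const, nsmul_eq_mul, Finset.card_univ]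
        rw [mul_comm (p ^ p)]
        congr 4
        exact funext fun x => Real.mul_rpow (by positivity) (hF01 x).1

/-- At least half of all values lie below twice the average bound. -/
theorem card_le_two_mul_card_filter {ι : Type*} (s : Finset ι) (w : ι → ℝ) {M : ℝ} (hM : 0 < M)
    (hw : ∀ a ∈ s, 0 ≤ w a) (h : ∑ a ∈ s, w a ≤ s.card * M) :
    (s.card : ℝ) ≤ 2 * (s.filter fun a => w a ≤ 2 * M).card := by
  have h1 : (s.filter fun a => ¬ w a ≤ 2 * M).card * (2 * M) ≤ s.card * M := by
    calc _ = ∑ a ∈ s.filter (fun a => ¬ w a ≤ 2 * M), 2 * M := by simp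
      _ ≤ ∑ a ∈ s.filter (fun a => ¬ w a ≤ 2 * M), w a :=
          Finset.sum_le_sum fun a ha => (not_le.mp (Finset.mem_filter.mp ha).2).le
      _ ≤ ∑ a ∈ s, w a :=
          Finset.sum_le_sum_of_subset_of_nonneg (Finset.filter_subset _ _) fun a ha _ => hw a ha
      _ ≤ _ := h
  have h2 : ((s.filter fun a => w a ≤ 2 * M).card : ℝ) +
      (s.filter fun a => ¬ w a ≤ 2 * M).card = s.card := by
    exact_mod_cast Finset.card_filter_add_card_filter_not _
  have h3 : ((s.filter fun a => ¬ w a ≤ 2 * M).card : ℝ) * 2 ≤ s.card := by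
    refine le_of_mul_le_mul_right ?_ hM
    linarith
  linarith

/-- Some point of `G^k` has many diagonal translates in a given set. -/
theorem exists_card_diagonal_translates (k : ℕ) (L : Finset (Fin k → G)) :
    ∃ z : Fin k → G, (L.card : ℝ) * Fintype.card G ≤
      (Finset.univ.filter fun t : G => (fun i => z i - t) ∈ L).card *
        (Fintype.card G : ℝ) ^ k := by
  have h1 : ∑ z : Fin k → G, (Finset.univ.filter fun t : G => (fun i => z i - t) ∈ L).card =
      Fintype.card G * L.card := by
    simp_rw [Finset.card_filter]
    rw [Finset.sum_comm]
    have : ∀ t : G, ∑ z : Fin k → G, (if (fun i => z i - t) ∈ L then 1 else 0) = L.card := by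
      intro t
      refine (Fintype.sum_equiv (Equiv.subRight (fun _ : Fin k => t)) _
        (fun z => if z ∈ L then 1 else 0) fun z => rfl).trans ?_
      simp
    simp [this]
  by_contra! hcon
  have h2 := Finset.sum_lt_sum_of_nonempty (Finset.univ_nonempty (α := Fin k → G))
    fun z _ => hcon z
  rw [← Finset.sum_mul, ← Nat.cast_sum, h1] at h2
  simp only [Finset.sum_const, Finset.card_univ, Fintype.card_fun, Fintype.card_fin,
    nsmul_eq_mul] at h2
  push_cast at h2
  linarith

/-- The Croot–Sisask lemma in `L^p`: a dense set of almost-periods of `f * μ_A`. -/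
theorem exists_almost_periods {f : G → ℝ} (hf : ∀ x, f x ∈ Set.Icc (0 : ℝ) 1) {A : Finset G}
    (hA : A.Nonempty) {p : ℝ} (hp : 2 ≤ p) {k : ℕ} (hk : 0 < k) :
    ∃ T : Finset G, T.Nonempty ∧
      ((A.card : ℝ) / Fintype.card G) ^ k * Fintype.card G ≤ 2 * T.card ∧
      ∀ t ∈ T, lpNorm p ((fun x => avgTranslate A f (x - t)) - avgTranslate A f) ≤
        2 * (2 * Real.exp 1 *
          (p + √(p * k) * lpNorm (p / 2) (avgTranslate A f) ^ ((1 : ℝ) / 2)) / k) := by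
  have hG : (0 : ℝ) < Fintype.card G := by
    have : Nonempty G := ⟨0⟩
    exact_mod_cast Fintype.card_pos
  have hp0 : 0 < p := by linarith
  have hA0 : (0 : ℝ) < A.card := by exact_mod_cast hA.card_pos
  have hk0 : (0 : ℝ) < k := by exact_mod_cast hk
  set F := avgTranslate A f with hF
  set y := √(p * k) * lpNorm (p / 2) F ^ ((1 : ℝ) / 2) with hy
  have hN := lpNorm_nonneg (p / 2) F
  have hy0 : 0 ≤ y := by positivity
  set δ := 2 * Real.exp 1 * (p + y) / k with hδ
  have hδ0 : 0 ≤ δ := by positivity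
  have hyp : y ^ p = (p * k) ^ (p / 2) * lpNorm (p / 2) F ^ (p / 2) := by
    rw [hy, Real.mul_rpow (by positivity) (by positivity), Real.sqrt_eq_rpow,
      ← Real.rpow_mul (by positivity), ← Real.rpow_mul hN]
    ring_nf
  set M := 2 * Real.exp p * (p ^ p + y ^ p) * Fintype.card G with hM
  have hM0 : 0 < M := by positivity
  have hMδ : 2 * M ≤ (k * δ) ^ p * Fintype.card G := by
    have h1 : k * δ = 2 * Real.exp 1 * (p + y) := by
      rw [hδ]
      field_simp
    rw [h1, Real.mul_rpow (by positivity) (by positivity),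
      Real.mul_rpow (by positivity) (by positivity), ← Real.exp_mul, one_mul, hM]
    have h2 : (4 : ℝ) ≤ 2 ^ p := by
      calc (4 : ℝ) = 2 ^ (2 : ℝ) := by norm_num
        _ ≤ _ := Real.rpow_le_rpow_of_exponent_le (by norm_num) hp
    calc _ = 4 * Real.exp p * (p ^ p + y ^ p) * Fintype.card G := by ring
      _ ≤ _ := by
        gcongr
        exact Real.add_rpow_le_rpow_add hp0.le hy0 (by linarith)
  set S := Fintype.piFinset (fun _ : Fin k => A) with hS
  set w : (Fin k → G) → ℝ := fun a => ∑ x, |∑ i, (f (x - a i) - F x)| ^ p with hw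
  set L := S.filter fun a => w a ≤ 2 * M with hL
  have hScard : (S.card : ℝ) = (A.card : ℝ) ^ k := by
    rw [hS, Fintype.card_piFinset_const]
    push_cast
    rfl
  have hLcard : (A.card : ℝ) ^ k ≤ 2 * L.card := by
    rw [← hScard]
    refine card_le_two_mul_card_filter S w hM0 (fun a _ => by positivity) ?_
    rw [hScard, hM, hyp]
    exact sum_piFinset_sum_rpow_le hf hA hp0 k
  have happrox : ∀ a ∈ L, lpNorm p ((fun x => (∑ i, f (x - a i)) / k) - F) ≤ δ := by
    intro a ha
    have h1 : ((fun x => (∑ i, f (x - a i)) / k) - F) =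
        fun x => (∑ i, (f (x - a i) - F x)) / k := by
      funext x
      simp only [Pi.sub_apply, Finset.sum_sub_distrib, Finset.sum_const, Finset.card_univ,
        Fintype.card_fin, nsmul_eq_mul]
      field_simp
    rw [h1, lpNorm_div hp0 _ hk0.le, div_le_iff₀ hk0, mul_comm]
    exact lpNorm_le_of_sum_le hp0 (by positivity) _ ((Finset.mem_filter.mp ha).2.trans hMδ)
  obtain ⟨z, hz⟩ := exists_card_diagonal_translates k L
  set T₀ := Finset.univ.filter fun t : G => (fun i => z i - t) ∈ L with hT₀
  have hT₀card : ((A.card : ℝ) / Fintype.card G) ^ k * Fintype.card G ≤ 2 * T₀.card := by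
    rw [div_pow, div_mul_eq_mul_div, div_le_iff₀ (by positivity)]
    nlinarith [mul_le_mul_of_nonneg_right hLcard hG.le]
  have hT₀ne : T₀.Nonempty := by
    rw [← Finset.card_pos]
    have : (0 : ℝ) < ((A.card : ℝ) / Fintype.card G) ^ k * Fintype.card G := by positivity
    have : (0 : ℝ) < T₀.card := by linarith
    exact_mod_cast this
  obtain ⟨t₀, ht₀⟩ := hT₀ne
  set H : G → ℝ := fun x => (∑ i, f (x - z i)) / k with hH
  have hshift : ∀ t ∈ T₀, lpNorm p (H - fun x => F (x - t)) ≤ δ := by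
    intro t ht
    have h1 := happrox _ (Finset.mem_filter.mp ht).2
    rw [← lpNorm_translate p _ t] at h1
    convert h1 using 2
    funext x
    simp only [Pi.sub_apply, hH]
    congr 3
    funext i
    congr 1
    abel
  refine ⟨T₀.image (· - t₀), ⟨_, Finset.mem_image_of_mem _ ht₀⟩, ?_, ?_⟩
  · rwa [Finset.card_image_of_injective _ (sub_left_injective)]
  · intro s hs
    obtain ⟨t, ht, rfl⟩ := Finset.mem_image.mp hs
    have h1 := lpNorm_add_le (by linarith : 1 ≤ p) (H - fun x => F (x - t₀))
      ((fun x => F (x - t)) - H)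
    rw [lpNorm_sub_comm p (fun x => F (x - t)), sub_add_sub_comm, add_comm H,
      add_sub_add_right_eq_sub] at h1
    have h2 : lpNorm p ((fun x => F (x - t)) - fun x => F (x - t₀)) ≤ 2 * δ := by
      linarith [hshift t ht, hshift t₀ ht₀]
    rw [← lpNorm_translate p _ (-t₀)] at h2
    convert h2 using 2
    funext x
    simp only [Pi.sub_apply]
    congr 2 <;> abel

/-! ### Characters of `𝔽₃ⁿ` -/

/-- The character `x ↦ e(γ · x / 3)` of `𝔽₃ⁿ`. -/
noncomputable def dotChar {n : ℕ} (γ x : Fin n → ZMod 3) : ℂ := ZMod.stdAddChar (γ ⬝ᵥ x)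

theorem dotChar_add {n : ℕ} (γ x y : Fin n → ZMod 3) :
    dotChar γ (x + y) = dotChar γ x * dotChar γ y := by
  simp [dotChar, dotProduct_add, AddChar.map_add_eq_mul]

theorem norm_dotChar {n : ℕ} (γ x : Fin n → ZMod 3) : ‖dotChar γ x‖ = 1 :=
  AddChar.norm_apply _ _

theorem conj_dotChar {n : ℕ} (γ x : Fin n → ZMod 3) :
    (starRingEnd ℂ) (dotChar γ x) = dotChar γ (-x) := by
  rw [dotChar, dotChar, dotProduct_neg, AddChar.map_neg_eq_conj]

theorem sum_dotChar {n : ℕ} (z : Fin n → ZMod 3) :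
    ∑ γ, dotChar γ z = if z = 0 then (3 : ℂ) ^ n else 0 := by
  split_ifs with hz
  · simp [dotChar, hz]
  · let ψ : AddChar (Fin n → ZMod 3) ℂ :=
      { toFun := fun γ => dotChar γ z
        map_zero_eq_one' := by simp [dotChar]
        map_add_eq_mul' := fun a b => by simp [dotChar, add_dotProduct, AddChar.map_add_eq_mul] }
    refine AddChar.sum_eq_zero_of_ne_one (ψ := ψ) fun h => hz ?_
    funext i
    have h1 : dotChar (Pi.single i 1) z = 1 := DFunLike.congr_fun h (Pi.single i 1)
    rw [dotChar, single_one_dotProduct, ← AddChar.map_zero_eq_one (ZMod.stdAddChar (N := 3))] at h1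
    exact ZMod.injective_stdAddChar h1

/-- The Fourier coefficient of `μ_T` at `γ`. -/
noncomputable def meanDotChar {n : ℕ} (T : Finset (Fin n → ZMod 3)) (γ : Fin n → ZMod 3) : ℂ :=
  (∑ t ∈ T, dotChar γ (-t)) / T.card

theorem norm_meanDotChar_le {n : ℕ} (T : Finset (Fin n → ZMod 3)) (γ : Fin n → ZMod 3) :
    ‖meanDotChar T γ‖ ≤ 1 := by
  rw [meanDotChar, norm_div, Complex.norm_natCast]
  refine div_le_one_of_le₀ ?_ (Nat.cast_nonneg _)
  calc _ ≤ ∑ t ∈ T, ‖dotChar γ (-t)‖ := norm_sum_le _ _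
    _ = T.card := by simp [norm_dotChar]

theorem avgTranslate_eq_sum_dotChar {n : ℕ} (T : Finset (Fin n → ZMod 3))
    {f : (Fin n → ZMod 3) → ℝ} {c : (Fin n → ZMod 3) → ℂ}
    (h : ∀ x, (f x : ℂ) = ∑ γ, c γ * dotChar γ x) (x : Fin n → ZMod 3) :
    (avgTranslate T f x : ℂ) = ∑ γ, c γ * meanDotChar T γ * dotChar γ x := by
  simp only [avgTranslate, Complex.ofReal_div, Complex.ofReal_sum, Complex.ofReal_natCast, h,
    sub_eq_add_neg, dotChar_add]
  rw [Finset.sum_comm, Finset.sum_div]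
  refine Finset.sum_congr rfl fun γ _ => ?_
  rw [meanDotChar, mul_div_assoc', div_mul_eq_mul_div, Finset.mul_sum, Finset.sum_mul]
  congr 1
  exact Finset.sum_congr rfl fun t _ => by ring

theorem iterate_avgTranslate_eq_sum_dotChar {n : ℕ} (T : Finset (Fin n → ZMod 3))
    {f : (Fin n → ZMod 3) → ℝ} {c : (Fin n → ZMod 3) → ℂ}
    (h : ∀ x, (f x : ℂ) = ∑ γ, c γ * dotChar γ x) (r : ℕ) (x : Fin n → ZMod 3) :
    ((avgTranslate T)^[r] f x : ℂ) = ∑ γ, c γ * meanDotChar T γ ^ r * dotChar γ x := by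
  induction r generalizing x with
  | zero => simpa using h x
  | succ r ih =>
    rw [Function.iterate_succ_apply', avgTranslate_eq_sum_dotChar T ih]
    exact Finset.sum_congr rfl fun γ _ => by ring

/-- The Fourier coefficients of `μ_A * 1_A` are absolutely summable with sum at most one. -/
theorem exists_dotChar_expansion {n : ℕ} {A : Finset (Fin n → ZMod 3)} (hA : A.Nonempty) :
    ∃ c : (Fin n → ZMod 3) → ℂ, ∑ γ, ‖c γ‖ ≤ 1 ∧
      ∀ x, (avgTranslate A (ind A) x : ℂ) = ∑ γ, c γ * dotChar γ x := by
  have hA0 : (A.card : ℂ) ≠ 0 := by exact_mod_cast hA.card_pos.ne'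
  have h3 : (3 : ℂ) ^ n ≠ 0 := pow_ne_zero _ (by norm_num)
  refine ⟨fun γ => (∑ y ∈ A, dotChar γ (-y)) ^ 2 / (A.card * 3 ^ n), le_of_eq ?_, fun x => ?_⟩
  · have key : ∑ γ, (‖∑ y ∈ A, dotChar γ (-y)‖ : ℂ) ^ 2 = A.card * 3 ^ n := by
      calc ∑ γ, (‖∑ y ∈ A, dotChar γ (-y)‖ : ℂ) ^ 2
          = ∑ γ, ∑ y ∈ A, ∑ z ∈ A, dotChar γ (z - y) := by
            refine Finset.sum_congr rfl fun γ _ => ?_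
            rw [← Complex.mul_conj', map_sum, Finset.sum_mul_sum]
            simp only [conj_dotChar, ← dotChar_add, neg_neg]
            refine Finset.sum_congr rfl fun y _ => Finset.sum_congr rfl fun z _ => ?_
            rw [neg_add_eq_sub]
        _ = ∑ y ∈ A, ∑ z ∈ A, if y = z then (3 : ℂ) ^ n else 0 := by
            rw [Finset.sum_comm]
            refine Finset.sum_congr rfl fun y _ => ?_
            rw [Finset.sum_comm]
            refine Finset.sum_congr rfl fun z _ => ?_
            simp only [sum_dotChar, sub_eq_zero, eq_comm (a := y)]
        _ = _ := by simp
    have key' : ∑ γ, ‖∑ y ∈ A, dotChar γ (-y)‖ ^ 2 = A.card * 3 ^ n := by exact_mod_cast key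
    simp only [norm_div, norm_pow, norm_mul, Complex.norm_natCast, RCLike.norm_ofNat]
    rw [← Finset.sum_div, key', div_self]
    exact_mod_cast mul_ne_zero hA0 h3
  · have key : ∑ γ, (∑ y ∈ A, dotChar γ (-y)) ^ 2 * dotChar γ x =
        3 ^ n * ∑ y ∈ A, ((ind A (x - y) : ℝ) : ℂ) := by
      calc ∑ γ, (∑ y ∈ A, dotChar γ (-y)) ^ 2 * dotChar γ x
          = ∑ γ, ∑ y ∈ A, ∑ z ∈ A, dotChar γ (x - y - z) := by
            refine Finset.sum_congr rfl fun γ _ => ?_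
            rw [sq, Finset.sum_mul_sum, Finset.sum_mul]
            refine Finset.sum_congr rfl fun y _ => ?_
            rw [Finset.sum_mul]
            refine Finset.sum_congr rfl fun z _ => ?_
            rw [← dotChar_add, ← dotChar_add]
            congr 1
            abel
        _ = ∑ y ∈ A, ∑ z ∈ A, if x - y = z then (3 : ℂ) ^ n else 0 := by
            rw [Finset.sum_comm]
            refine Finset.sum_congr rfl fun y _ => ?_
            rw [Finset.sum_comm]
            refine Finset.sum_congr rfl fun z _ => ?_
            simp only [sum_dotChar, sub_eq_zero]
        _ = _ := by
            rw [Finset.mul_sum]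
            refine Finset.sum_congr rfl fun y _ => ?_
            simp only [ind, Finset.sum_ite_eq]
            split_ifs <;> simp
    simp only [div_mul_eq_mul_div]
    rw [← Finset.sum_div, key]
    simp only [avgTranslate, Complex.ofReal_div, Complex.ofReal_sum, Complex.ofReal_natCast]
    field_simp

/-- Convolution with `μ_V` barely changes a function smoothed by many convolutions with `μ_T`,
when `V` annihilates the large spectrum of `T`. -/
theorem abs_avgTranslate_iterate_sub_le {n : ℕ} {A T W : Finset (Fin n → ZMod 3)}
    (hA : A.Nonempty) (hW : W.Nonempty)
    (h : ∀ γ, 1 / 2 ≤ ‖meanDotChar T γ‖ → ∀ v ∈ W, γ ⬝ᵥ v = 0) (r : ℕ) (x : Fin n → ZMod 3) :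
    |(avgTranslate W ((avgTranslate T)^[r] (avgTranslate A (ind A))) -
      (avgTranslate T)^[r] (avgTranslate A (ind A))) x| ≤ 2 * (1 / 2) ^ r := by
  obtain ⟨c, hc, hcF⟩ := exists_dotChar_expansion hA
  have hT := iterate_avgTranslate_eq_sum_dotChar T hcF r
  have hWT := avgTranslate_eq_sum_dotChar W hT x
  have hbound : ∀ γ, ‖meanDotChar T γ ^ r * (meanDotChar W γ - 1)‖ ≤ 2 * (1 / 2) ^ r := by
    intro γ
    by_cases hγ : 1 / 2 ≤ ‖meanDotChar T γ‖
    · have h1 : meanDotChar W γ = 1 := by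
        have hW0 : (W.card : ℂ) ≠ 0 := by exact_mod_cast hW.card_pos.ne'
        rw [meanDotChar, div_eq_one_iff_eq hW0]
        calc ∑ v ∈ W, dotChar γ (-v) = ∑ _v ∈ W, (1 : ℂ) :=
              Finset.sum_congr rfl fun v hv => by simp [dotChar, h γ hγ v hv]
          _ = W.card := by simp
      rw [h1, sub_self, mul_zero, norm_zero]
      positivity
    · push Not at hγ
      rw [norm_mul, norm_pow, mul_comm]
      gcongr
      calc _ ≤ ‖meanDotChar W γ‖ + ‖(1 : ℂ)‖ := norm_sub_le _ _
        _ ≤ 1 + 1 := by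
          rw [norm_one]
          gcongr
          exact norm_meanDotChar_le _ _
        _ = 2 := by norm_num
  rw [Pi.sub_apply, ← Real.norm_eq_abs, ← Complex.norm_real, Complex.ofReal_sub, hWT, hT, ← Finset.sum_sub_distrib]
  calc _ ≤ ∑ γ, ‖c γ‖ * (2 * (1 / 2) ^ r) := by
        refine norm_sum_le_of_le _ fun γ _ => ?_
        rw [show c γ * meanDotChar T γ ^ r * meanDotChar W γ * dotChar γ x -
          c γ * meanDotChar T γ ^ r * dotChar γ x =
            c γ * (meanDotChar T γ ^ r * (meanDotChar W γ - 1)) * dotChar γ x by ring,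
          norm_mul, norm_mul, norm_dotChar, mul_one]
        gcongr
        exact hbound γ
    _ ≤ 1 * (2 * (1 / 2) ^ r) := by
        rw [← Finset.sum_mul]
        gcongr
    _ = _ := one_mul _

/-! ### The dimension of the large spectrum -/

/-- Linearly independent linear forms on `𝔽₃ⁿ` are independent as random variables. -/
theorem sum_prod_dotProduct {n : ℕ} {ι : Type*} [Fintype ι] {γ : ι → Fin n → ZMod 3}
    (hγ : LinearIndependent (ZMod 3) γ) (φ : ι → ZMod 3 → ℝ) :
    (3 : ℝ) ^ Fintype.card ι * ∑ x, ∏ i, φ i (γ i ⬝ᵥ x) = 3 ^ n * ∏ i, ∑ a, φ i a := by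
  let Φ : (Fin n → ZMod 3) →ₗ[ZMod 3] (ι → ZMod 3) := (Matrix.of γ).mulVecLin
  have hΦ : ∀ x i, Φ x i = γ i ⬝ᵥ x := fun x i => rfl
  have hsurj : Function.Surjective Φ := by
    rw [← LinearMap.range_eq_top]
    apply Submodule.eq_top_of_finrank_eq
    rw [Module.finrank_fintype_fun_eq_card]
    exact LinearIndependent.rank_matrix (M := Matrix.of γ) hγ
  have hfib : ∀ y, (Finset.univ.filter fun x => Φ x = y).card =
      (Finset.univ.filter fun x => Φ x = 0).card := fun y =>
    AddMonoidHom.card_fiber_eq_of_mem_range Φ (hsurj y) (hsurj 0)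
  set K := (Finset.univ.filter fun x => Φ x = 0).card
  have hsum : ∀ g : (ι → ZMod 3) → ℝ, ∑ x, g (Φ x) = K * ∑ y, g y := by
    intro g
    rw [← Finset.sum_fiberwise Finset.univ Φ, Finset.mul_sum]
    refine Finset.sum_congr rfl fun y _ => ?_
    rw [← hfib y, ← nsmul_eq_mul, ← Finset.sum_const]
    exact Finset.sum_congr rfl fun x hx => by rw [(Finset.mem_filter.mp hx).2]
  have hK : (3 : ℝ) ^ n = K * 3 ^ Fintype.card ι := by
    simpa using hsum fun _ => 1
  have hprod : ∏ i, ∑ a, φ i a = ∑ y : ι → ZMod 3, ∏ i, φ i (y i) := by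
    rw [Finset.prod_univ_sum, Fintype.piFinset_univ]
  have hmain := hsum fun y => ∏ i, φ i (y i)
  simp only [hΦ] at hmain
  rw [hmain, hprod, hK]
  ring

/-- Chang's lemma for independent characters. -/
theorem card_mul_exp_le_of_linearIndependent {n : ℕ} {ι : Type*} [Fintype ι]
    {γ : ι → Fin n → ZMod 3} (hγ : LinearIndependent (ZMod 3) γ) {T : Finset (Fin n → ZMod 3)}
    (hT : T.Nonempty) (h : ∀ i, 1 / 2 ≤ ‖meanDotChar T (γ i)‖) :
    T.card * Real.exp (Fintype.card ι / 16) ≤ 3 ^ n := by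
  have hT0 : (0 : ℝ) < T.card := by exact_mod_cast hT.card_pos
  have hu : ∀ i, ∃ u : ZMod 3 → ℝ, ∑ a, u a = 0 ∧ (∀ a, |u a| ≤ 1) ∧
      1 / 2 * T.card ≤ ∑ t ∈ T, u (γ i ⬝ᵥ t) := by
    intro i
    set m := meanDotChar T (γ i) with hm
    have hm0 : 0 < ‖m‖ := lt_of_lt_of_le (by norm_num) (h i)
    set w := (starRingEnd ℂ) m / ‖m‖ with hw
    have hw1 : ‖w‖ = 1 := by
      rw [hw, norm_div, RCLike.norm_conj, Complex.norm_real, norm_norm, div_self hm0.ne']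
    have hwm : w * m = ‖m‖ := by
      have : (‖m‖ : ℂ) ≠ 0 := by exact_mod_cast hm0.ne'
      rw [hw, div_mul_eq_mul_div, Complex.conj_mul', sq, mul_div_cancel_right₀ _ this]
    refine ⟨fun a => (w * ZMod.stdAddChar (-a)).re, ?_, fun a => ?_, ?_⟩
    · rw [← Complex.re_sum, ← Finset.mul_sum,
        Fintype.sum_equiv (Equiv.neg (ZMod 3)) (fun a => (ZMod.stdAddChar (-a) : ℂ))
          (fun a => ZMod.stdAddChar a) fun a => rfl, AddChar.sum_eq_zero_of_ne_one]
      · simp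
      · intro h1
        have h2 : ZMod.stdAddChar (1 : ZMod 3) = ZMod.stdAddChar (0 : ZMod 3) := by
          rw [h1]
          simp
        exact absurd (ZMod.injective_stdAddChar h2) (by decide)
    · refine (Complex.abs_re_le_norm _).trans ?_
      rw [norm_mul, hw1, one_mul, AddChar.norm_apply]
    · have h1 : ∑ t ∈ T, w * (ZMod.stdAddChar (-(γ i ⬝ᵥ t)) : ℂ) = (‖m‖ * T.card : ℝ) := by
        have hTC : (T.card : ℂ) ≠ 0 := by exact_mod_cast hT0.ne'
        push_cast
        rw [← Finset.mul_sum, ← hwm, mul_assoc, hm, meanDotChar, div_mul_cancel₀ _ hTC]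
        simp [dotChar]
      rw [← Complex.re_sum, h1, Complex.ofReal_re]
      gcongr
      exact h i
  choose u hu0 hu1 huT using hu
  have hupper : ∑ x, Real.exp (∑ i, u i (γ i ⬝ᵥ x) / 4) ≤
      3 ^ n * Real.exp (Fintype.card ι / 16) := by
    have h1 : ∀ i, ∑ a, Real.exp (u i a / 4) ≤ 3 * Real.exp (1 / 16) := by
      intro i
      calc ∑ a, Real.exp (u i a / 4) ≤ ∑ a, (1 + u i a / 4 + 1 / 16) := by
            gcongr with a
            have h2 := abs_le.mp (hu1 i a)
            have h3 : |u i a / 4| ≤ 1 := abs_le.mpr ⟨by linarith, by linarith⟩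
            have := (abs_le.mp (Real.abs_exp_sub_one_sub_id_le h3)).2
            nlinarith
        _ = 3 * (1 / 16 + 1) := by
            rw [Finset.sum_add_distrib, Finset.sum_add_distrib, ← Finset.sum_div, hu0 i]
            simp
            norm_num
        _ ≤ _ := by
            gcongr
            exact Real.add_one_le_exp _
    have h2 := sum_prod_dotProduct hγ fun i a => Real.exp (u i a / 4)
    simp only [← Real.exp_sum] at h2
    have h3 : ∏ i, ∑ a, Real.exp (u i a / 4) ≤ 3 ^ Fintype.card ι *
        Real.exp (Fintype.card ι / 16) := by
      calc _ ≤ ∏ _i : ι, 3 * Real.exp (1 / 16) :=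
            Finset.prod_le_prod (fun i _ => by positivity) fun i _ => h1 i
        _ = _ := by
          rw [Finset.prod_const, Finset.card_univ, mul_pow, ← Real.exp_nat_mul, mul_one_div]
    refine le_of_mul_le_mul_left ?_ (by positivity : (0 : ℝ) < 3 ^ Fintype.card ι)
    rw [h2]
    calc _ ≤ (3 : ℝ) ^ n * (3 ^ Fintype.card ι * Real.exp (Fintype.card ι / 16)) := by gcongr
      _ = _ := by ring
  have hlower : T.card * Real.exp (Fintype.card ι / 8) ≤
      ∑ x, Real.exp (∑ i, u i (γ i ⬝ᵥ x) / 4) := by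
    set d : ℝ := Fintype.card ι / 8 with hd
    have h1 : T.card * d ≤ ∑ t ∈ T, ∑ i, u i (γ i ⬝ᵥ t) / 4 := by
      rw [Finset.sum_comm]
      calc T.card * d = ∑ _i : ι, 1 / 2 * (T.card : ℝ) / 4 := by
            simp [hd]
            ring
        _ ≤ ∑ i, ∑ t ∈ T, u i (γ i ⬝ᵥ t) / 4 := by
            gcongr with i
            rw [← Finset.sum_div]
            gcongr
            exact huT i
    calc T.card * Real.exp d ≤ Real.exp d * ∑ t ∈ T, (∑ i, u i (γ i ⬝ᵥ t) / 4 - d + 1) := by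
          rw [mul_comm]
          gcongr
          rw [Finset.sum_add_distrib, Finset.sum_sub_distrib]
          simp only [Finset.sum_const, nsmul_eq_mul, mul_one]
          linarith
      _ ≤ Real.exp d * ∑ t ∈ T, Real.exp (∑ i, u i (γ i ⬝ᵥ t) / 4 - d) := by
          gcongr with t
          exact Real.add_one_le_exp _
      _ = ∑ t ∈ T, Real.exp (∑ i, u i (γ i ⬝ᵥ t) / 4) := by
          rw [Finset.mul_sum]
          refine Finset.sum_congr rfl fun t _ => ?_
          rw [← Real.exp_add, add_sub_cancel]
      _ ≤ _ := Finset.sum_le_sum_of_subset_of_nonneg (Finset.subset_univ _)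
          fun _ _ _ => (Real.exp_pos _).le
  refine le_of_mul_le_mul_right ?_ (Real.exp_pos (Fintype.card ι / 16))
  rw [mul_assoc, ← Real.exp_add, ← add_div, ← two_mul]
  convert hlower.trans hupper using 3
  ring

/-- A subspace of small codimension annihilating the large spectrum of `T`. -/
theorem exists_submodule_annihilating {n : ℕ} {T : Finset (Fin n → ZMod 3)} (hT : T.Nonempty) :
    ∃ V : Submodule (ZMod 3) (Fin n → ZMod 3),
      T.card * Real.exp (((n : ℝ) - Module.finrank (ZMod 3) V) / 16) ≤ 3 ^ n ∧
      ∀ γ, 1 / 2 ≤ ‖meanDotChar T γ‖ → ∀ v ∈ V, γ ⬝ᵥ v = 0 := by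
  obtain ⟨b, hbs, hspan, hli⟩ :=
    exists_linearIndependent (ZMod 3) {γ : Fin n → ZMod 3 | 1 / 2 ≤ ‖meanDotChar T γ‖}
  let M : Matrix b (Fin n) (ZMod 3) := Matrix.of fun i => i.1
  refine ⟨M.mulVecLin.ker, ?_, fun γ hγ v hv => ?_⟩
  · have h1 : Module.finrank (ZMod 3) M.mulVecLin.range = Fintype.card b :=
      LinearIndependent.rank_matrix (M := M) hli
    have h2 := LinearMap.finrank_range_add_finrank_ker M.mulVecLin
    rw [h1, Module.finrank_fin_fun] at h2
    have h3 : (n : ℝ) - Module.finrank (ZMod 3) M.mulVecLin.ker = Fintype.card b := by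
      rw [sub_eq_iff_eq_add]
      exact_mod_cast h2.symm
    rw [h3]
    exact card_mul_exp_le_of_linearIndependent hli hT fun i => hbs i.2
  · have h1 : γ ∈ Submodule.span (ZMod 3) b := by
      rw [hspan]
      exact Submodule.subset_span hγ
    clear hγ
    induction h1 using Submodule.span_induction with
    | mem x hx => exact congrFun (LinearMap.mem_ker.mp hv) ⟨x, hx⟩
    | zero => simp
    | add x y _ _ hx hy => rw [add_dotProduct, hx, hy, add_zero]
    | smul a x _ hx => rw [smul_dotProduct, hx, smul_zero]

/-! ### The main theorem -/

theorem conv_nindSub {n : ℕ} (f : (Fin n → ZMod 3) → ℝ)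
    (V : Submodule (ZMod 3) (Fin n → ZMod 3)) :
    conv f (nindSub V) = avgTranslate (Finset.univ.filter (· ∈ V)) f := by
  rw [← conv_nind]
  congr 1
  funext x
  have h1 : Nat.card V = (Finset.univ.filter (· ∈ V)).card := by
    rw [Nat.card_eq_fintype_card, Fintype.card_subtype]
  simp only [nindSub, nind, h1, Finset.mem_filter, Finset.mem_univ, true_and]
  simp

omit [AddCommGroup G] [Fintype G] in
theorem ind_mem_Icc (A : Finset G) (x : G) : ind A x ∈ Set.Icc (0 : ℝ) 1 := by
  unfold ind
  split_ifs <;> simp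

theorem avgTranslate_univ_ind {A : Finset G} (hA : A.Nonempty) (x : G) :
    avgTranslate Finset.univ (avgTranslate A (ind A)) x = (A.card : ℝ) / Fintype.card G := by
  have hA0 : (A.card : ℝ) ≠ 0 := by exact_mod_cast hA.card_pos.ne'
  have h1 : ∀ a, ∑ t, ind A (x - t - a) = A.card := fun a => by
    rw [Fintype.sum_equiv ((Equiv.subLeft x).trans (Equiv.subRight a))
      (fun t => ind A (x - t - a)) (ind A) fun t => rfl]
    simp [ind]
  simp only [avgTranslate, Finset.card_univ]
  rw [← Finset.sum_div, Finset.sum_comm]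
  simp only [h1, Finset.sum_const, nsmul_eq_mul, mul_div_cancel_right₀ _ hA0]

theorem le_lpNorm_avgTranslate_ind {A : Finset G} (hA : A.Nonempty) {q : ℝ} (hq : 1 ≤ q) :
    (A.card : ℝ) / Fintype.card G ≤ lpNorm q (avgTranslate A (ind A)) := by
  have hG : (Fintype.card G : ℝ) ≠ 0 := by
    have : Nonempty G := ⟨0⟩
    exact_mod_cast Fintype.card_ne_zero
  have hF := avgTranslate_mem_Icc (ind_mem_Icc A) A
  have h1 := Real.arith_mean_le_rpow_mean Finset.univ (fun _ => (1 : ℝ) / Fintype.card G)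
    (avgTranslate A (ind A)) (fun _ _ => by positivity) (by simp [hG])
    (fun x _ => (hF x).1) hq
  have h2 : ∑ x, (1 : ℝ) / Fintype.card G * avgTranslate A (ind A) x =
      A.card / Fintype.card G := by
    rw [← avgTranslate_univ_ind hA 0, ← Finset.mul_sum, avgTranslate, Finset.card_univ,
      one_div_mul_eq_div]
    congr 1
    exact Fintype.sum_equiv (Equiv.neg G) _ _ fun x => by simp
  rw [h2, ← Finset.mul_sum, one_div_mul_eq_div] at h1
  refine h1.trans_eq ?_
  unfold lpNorm expect
  congr 2
  exact Finset.sum_congr rfl fun x _ => by simp only [abs_of_nonneg (hF x).1]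

/-- When `ε α ≥ 1 / 3` the whole group already works. -/
theorem lpNorm_avgTranslate_univ_sub_le {A : Finset G} (hA : A.Nonempty) {p ε : ℝ} (hp : 2 ≤ p)
    (hε0 : 0 < ε) (hε1 : ε < 1) (hα : (A.card : ℝ) / Fintype.card G ≤ 1 / 2)
    (h : 1 / 3 ≤ ε * ((A.card : ℝ) / Fintype.card G)) :
    lpNorm p (avgTranslate Finset.univ (avgTranslate A (ind A)) - avgTranslate A (ind A)) ≤
      ε * lpNorm (p / 2) (avgTranslate A (ind A)) ^ ((1 : ℝ) / 2) + ε ^ 2 := by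
  have hN := le_lpNorm_avgTranslate_ind hA (q := p / 2) (by linarith)
  set α := (A.card : ℝ) / Fintype.card G with hα'
  have hα0 : 0 ≤ α := by positivity
  have hε : 2 / 3 ≤ ε := by nlinarith
  have hα3 : 1 / 3 ≤ α := by nlinarith
  have h1 : 1 / 2 ≤ lpNorm (p / 2) (avgTranslate A (ind A)) ^ ((1 : ℝ) / 2) := by
    rw [← Real.sqrt_eq_rpow]
    exact Real.le_sqrt_of_sq_le (by linarith)
  calc _ ≤ 1 - α := by
        refine lpNorm_le_of_forall (by linarith) _ fun x => ?_
        have hF := avgTranslate_mem_Icc (ind_mem_Icc A) A x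
        rw [Pi.sub_apply, avgTranslate_univ_ind hA, ← hα']
        exact abs_le.mpr ⟨by linarith [hF.2], by linarith [hF.1]⟩
    _ ≤ ε * (1 / 2) + ε ^ 2 := by nlinarith
    _ ≤ _ := by gcongr

/-- The case `ε α < 1 / 3`, with `r` smoothing steps and samples of size `k`. -/
theorem exists_submodule_lpNorm_le {n : ℕ} {A : Finset (Fin n → ZMod 3)} (hA : A.Nonempty)
    {p ε : ℝ} (hp : 2 ≤ p) (hε0 : 0 < ε) {r k : ℕ} (hr : 0 < r)
    (hr' : (1 / 2 : ℝ) ^ r ≤ ε ^ 2 / 4) (hk : 2500 * (r : ℝ) ^ 2 * p / ε ^ 2 ≤ k) :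
    ∃ V : Submodule (ZMod 3) (Fin n → ZMod 3),
      ((A.card : ℝ) / 3 ^ n) ^ k * Real.exp (((n : ℝ) - Module.finrank (ZMod 3) V) / 16) ≤ 2 ∧
      lpNorm p (avgTranslate (Finset.univ.filter (· ∈ V)) (avgTranslate A (ind A)) -
        avgTranslate A (ind A)) ≤
        ε * lpNorm (p / 2) (avgTranslate A (ind A)) ^ ((1 : ℝ) / 2) + ε ^ 2 := by
  have hr0 : (0 : ℝ) < r := by exact_mod_cast hr
  have hr1 : (1 : ℝ) ≤ r := by exact_mod_cast hr
  have hk0 : (0 : ℝ) < k := lt_of_lt_of_le (by positivity) hk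
  have hp1 : 1 ≤ p := by linarith
  have hp0 : 0 < p := by linarith
  obtain ⟨T, hT, hTcard, hTB⟩ :=
    exists_almost_periods (ind_mem_Icc A) hA hp (by exact_mod_cast hk0 : 0 < k)
  obtain ⟨V, hV, hVT⟩ := exists_submodule_annihilating hT
  have hcard : (Fintype.card (Fin n → ZMod 3) : ℝ) = 3 ^ n := by simp
  rw [hcard] at hTcard
  refine ⟨V, ?_, ?_⟩
  · refine le_of_mul_le_mul_right ?_ (by positivity : (0 : ℝ) < 3 ^ n)
    nlinarith [mul_le_mul_of_nonneg_right hTcard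
      (Real.exp_pos (((n : ℝ) - Module.finrank (ZMod 3) V) / 16)).le]
  · set F := avgTranslate A (ind A) with hF
    set s := lpNorm (p / 2) F ^ ((1 : ℝ) / 2) with hs
    have hs0 : 0 ≤ s := Real.rpow_nonneg (lpNorm_nonneg _ _) _
    set W : Finset (Fin n → ZMod 3) := Finset.univ.filter (· ∈ V) with hWdef
    have hW : W.Nonempty := ⟨0, by simp [hWdef]⟩
    set H := (avgTranslate T)^[r] F with hH
    have hHF := lpNorm_iterate_avgTranslate_sub_le hp1 hT F hTB r
    rw [← hH] at hHF
    have hmid : lpNorm p (avgTranslate W H - H) ≤ 2 * (1 / 2) ^ r :=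
      lpNorm_le_of_forall hp0 _ fun x => abs_avgTranslate_iterate_sub_le hA hW
        (fun γ hγ v hv => hVT γ hγ v (Finset.mem_filter.mp hv).2) r x
    have hdecomp : avgTranslate W F - F =
        avgTranslate W (F - H) + ((avgTranslate W H - H) + (H - F)) := by
      rw [avgTranslate_sub]
      abel
    have hpk : p / k ≤ (ε / (50 * r)) ^ 2 := by
      rw [div_le_iff₀ (by positivity)] at hk
      rw [div_pow, div_le_div_iff₀ hk0 (by positivity)]
      nlinarith
    have hsqrt : √(p * k) / k ≤ ε / (50 * r) := by
      rw [div_le_iff₀ hk0] at hpk ⊢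
      refine Real.sqrt_le_iff.mpr ⟨by positivity, ?_⟩
      nlinarith
    have herr : 2 * (r * (2 * (2 * Real.exp 1 * (p + √(p * k) * s) / k))) ≤
        ε * s + ε ^ 2 / 2 := by
      have he : Real.exp 1 ≤ 11 / 4 := by linarith [Real.exp_one_lt_d9]
      calc _ = 8 * Real.exp 1 * r * (p / k + √(p * k) / k * s) := by ring
        _ ≤ 8 * (11 / 4) * r * ((ε / (50 * r)) ^ 2 + ε / (50 * r) * s) := by gcongr
        _ = 22 / 50 * (ε * s) + 22 / 2500 * (ε ^ 2 / r) := by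
            field_simp
            ring
        _ ≤ _ := by
            have h1 : ε ^ 2 / r ≤ ε ^ 2 := div_le_self (by positivity) hr1
            have h2 : 0 ≤ ε * s := by positivity
            have h3 : 0 ≤ ε ^ 2 := by positivity
            linarith
    rw [hdecomp]
    calc _ ≤ lpNorm p (avgTranslate W (F - H)) +
          (lpNorm p (avgTranslate W H - H) + lpNorm p (H - F)) :=
          (lpNorm_add_le hp1 _ _).trans (by gcongr; exact lpNorm_add_le hp1 _ _)
      _ ≤ lpNorm p (H - F) + (2 * (1 / 2) ^ r + lpNorm p (H - F)) := by
          gcongr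
          rw [lpNorm_sub_comm p H]
          exact lpNorm_avgTranslate_le hp1 hW _
      _ ≤ _ := by linarith

/-- `L^p` almost-periodicity (Bloom–Sisask, finite field model): for `A ⊆ 𝔽₃ⁿ` of density
`α ≤ 1/2` there is a subspace `V` of codimension `≲_{ε,α} p/ε²` with
`‖μ_A * 1_A * μ_V − μ_A * 1_A‖_{L^p} ≤ ε‖μ_A * 1_A‖_{L^{p/2}}^{1/2} + ε²`. -/
theorem lp_almost_periodicity :
    ∃ C : ℝ, 0 < C ∧
      ∀ (n : ℕ) (p ε : ℝ) (A : Finset (Fin n → ZMod 3)), 2 ≤ p → 0 < ε → ε < 1 →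
        A.Nonempty → (A.card : ℝ) / 3 ^ n ≤ 1 / 2 →
        ∃ V : Submodule (ZMod 3) (Fin n → ZMod 3),
          (n : ℝ) - Module.finrank (ZMod 3) V ≤
            C * (Real.log (1 / (ε * ((A.card : ℝ) / 3 ^ n)))) ^ C * p / ε ^ 2 ∧
          lpNorm p (conv (conv (nind A) (ind A)) (nindSub V) - conv (nind A) (ind A)) ≤
            ε * (lpNorm (p / 2) (conv (nind A) (ind A))) ^ ((1 : ℝ) / 2) + ε ^ 2 := by
  refine ⟨3000000, by norm_num, fun n p ε A hp hε0 hε1 hA hα => ?_⟩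
  have hcard : (Fintype.card (Fin n → ZMod 3) : ℝ) = 3 ^ n := by simp
  have hA0 : (0 : ℝ) < A.card := by exact_mod_cast hA.card_pos
  rw [conv_comm (nind A), conv_nind]
  simp only [conv_nindSub]
  set α := (A.card : ℝ) / 3 ^ n with hαdef
  have hα0 : 0 < α := by positivity
  have hεα : 0 < ε * α := by positivity
  set L := Real.log (1 / (ε * α)) with hL
  by_cases h : 1 / 3 ≤ ε * α
  · refine ⟨⊤, ?_, ?_⟩
    · have hL0 : 0 ≤ L := Real.log_nonneg (by
        rw [le_div_iff₀ hεα]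
        nlinarith)
      rw [finrank_top, Module.finrank_fin_fun, sub_self]
      positivity
    · simp only [Submodule.mem_top, Finset.filter_true]
      exact lpNorm_avgTranslate_univ_sub_le hA hp hε0 hε1 (by rwa [hcard]) (by rwa [hcard])
  · push Not at h
    have hexpL : Real.exp (-L) = ε * α := by
      rw [hL, Real.exp_neg, Real.exp_log (by positivity), one_div, inv_inv]
    have hL1 : 1 ≤ L := by
      rw [hL, Real.le_log_iff_exp_le (by positivity), le_div_iff₀ hεα]
      nlinarith [Real.exp_one_lt_d9]
    have hlogα : -Real.log α ≤ L := by
      rw [hL, one_div, Real.log_inv, Real.log_mul hε0.ne' hα0.ne']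
      linarith [Real.log_neg hε0 hε1]
    set r := ⌈5 * L⌉₊ with hr
    have hr5 : 5 * L ≤ r := Nat.le_ceil _
    have hr6 : (r : ℝ) ≤ 6 * L := by linarith [Nat.ceil_lt_add_one (by linarith : 0 ≤ 5 * L)]
    have hr0 : 0 < r := Nat.ceil_pos.mpr (by linarith)
    have hr1 : (1 : ℝ) ≤ r := by exact_mod_cast hr0
    have hr' : (1 / 2 : ℝ) ^ r ≤ ε ^ 2 / 4 := by
      calc (1 / 2 : ℝ) ^ r = Real.exp (-(r * Real.log 2)) := by
            rw [Real.exp_neg, Real.exp_nat_mul, Real.exp_log two_pos, one_div, inv_pow]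
        _ ≤ Real.exp (-L + -L) := by
            gcongr
            nlinarith [Real.log_two_gt_d9]
        _ = ε ^ 2 * α ^ 2 := by
            rw [Real.exp_add, hexpL]
            ring
        _ ≤ ε ^ 2 * (1 / 2) ^ 2 := by gcongr
        _ = _ := by ring
    set k := ⌈2500 * (r : ℝ) ^ 2 * p / ε ^ 2⌉₊ with hk
    have hq : 1 ≤ (r : ℝ) ^ 2 * p / ε ^ 2 := by
      rw [le_div_iff₀ (by positivity)]
      nlinarith
    have hk1 : (k : ℝ) ≤ 2501 * ((r : ℝ) ^ 2 * p / ε ^ 2) := by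
      have h1 := Nat.ceil_lt_add_one (by positivity : 0 ≤ 2500 * (r : ℝ) ^ 2 * p / ε ^ 2)
      rw [← hk, mul_assoc 2500, mul_div_assoc] at h1
      linarith
    have hk0 : (1 : ℝ) ≤ k := by
      have := Nat.le_ceil (2500 * (r : ℝ) ^ 2 * p / ε ^ 2)
      rw [← hk, mul_assoc 2500, mul_div_assoc] at this
      linarith
    obtain ⟨V, hV, hVp⟩ := exists_submodule_lpNorm_le hA hp hε0 hr0 hr' (Nat.le_ceil _)
    refine ⟨V, ?_, hVp⟩
    rw [← hαdef, ← hk] at hV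
    set d : ℝ := (n : ℝ) - Module.finrank (ZMod 3) V with hd
    have hd1 : k * Real.log α + d / 16 ≤ Real.log 2 := by
      have := Real.log_le_log (by positivity) hV
      rwa [Real.log_mul (by positivity) (Real.exp_ne_zero _), Real.log_pow, Real.log_exp] at this
    have hd2 : d ≤ 32 * (k * L) := by
      have h1 : k * -Real.log α ≤ k * L := by gcongr
      have h2 : L ≤ k * L := le_mul_of_one_le_left (by linarith) hk0
      linarith [Real.log_two_lt_d9]
    calc d ≤ 32 * (2501 * ((6 * L) ^ 2 * p / ε ^ 2) * L) := by
          refine hd2.trans ?_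
          gcongr
          exact hk1.trans (by gcongr)
      _ = 2881152 * L ^ (3 : ℝ) * p / ε ^ 2 := by
          norm_cast
          ring
      _ ≤ _ := by
          gcongr
          · norm_num
          · norm_num
end
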